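/- arXiv:0907.0958 — 3 statements merged into one kernel-verified Lean document; each statement's English description precedes it below -/
import Mathlib

section
/- Let Σ₉ = {x = (x_{ef})_{e,f ∈ {1,2,3}} ∈ [0,1]^9 : Σ_{e,f} x_{ef} = 1}. For x ∈ Σ₉ define σ_e = Σ_{f ≠ e} x_{ef}, τ_e = Σ_{f ≠ e} x_{fe}, and γ_e = Σ_{f ≠ e, f' ≠ e} x_{ff'}, and let φ(x) = (1/2) Σ_{e=1}^3 [σ_e ln σ_e + τ_e ln τ_e + γ_e ln γ_e − x_{ee} ln x_{ee} − 2 Σ_{f ≠ e} x_{ef} ln x_{ef}] (with 0·ln 0 = 0). Then φ attains its maximum on Σ₉ at the unique point with x_{ef} = 1/9 for all e, f, and the maximum value is ln(4/3). -/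
open Real in
/-- The tangent-line (Gibbs) bound for `x log (y / x)`. -/
theorem mul_log_sub_mul_log_le {x y : ℝ} (hx : 0 ≤ x) (hy : 0 ≤ y) (hxy : 0 < x → 0 < y) :
    x * log y - x * log x ≤ y - x := by
  rcases hx.eq_or_lt with rfl | hx
  · simpa using hy
  have hy := hxy hx
  have h := mul_le_mul_of_nonneg_left (log_le_sub_one_of_pos (div_pos hy hx)) hx.le
  rw [log_div hy.ne' hx.ne', mul_sub, mul_sub, mul_div_cancel₀ _ hx.ne'] at h
  linarith

open Real in
/-- The equality case of `mul_log_sub_mul_log_le`. -/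
theorem eq_of_sub_le_mul_log_sub_mul_log {x y : ℝ} (hx : 0 ≤ x) (hy : 0 ≤ y)
    (hxy : 0 < x → 0 < y) (h : y - x ≤ x * log y - x * log x) : x = y := by
  rcases hx.eq_or_lt with rfl | hx
  · exact hy.antisymm (by simpa using h)
  have hy := hxy hx
  by_contra hne
  have hlt := mul_lt_mul_of_pos_left (log_lt_sub_one_of_pos (div_pos hy hx)
    (fun h1 => hne ((div_eq_one_iff_eq hx.ne').1 h1).symm)) hx
  rw [log_div hy.ne' hx.ne', mul_sub, mul_sub, mul_div_cancel₀ _ hx.ne'] at hlt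
  linarith

open Real in
theorem diagonal_term_le {x g k : ℝ} (hx : 0 ≤ x) (hg : x ≤ g) (hk : x ≤ k) :
    x * (log g + log k) - x * log x ≤ x * log (16 / 9) + (9 / 16 * (g * k) - x) ∧
    (x * log (16 / 9) + (9 / 16 * (g * k) - x) ≤ x * (log g + log k) - x * log x →
      x = 9 / 16 * (g * k)) := by
  have hg0 := hx.trans hg
  have hk0 := hx.trans hk
  have hy : 0 ≤ 9 / 16 * (g * k) := by positivity
  have hxy : 0 < x → 0 < 9 / 16 * (g * k) := fun h => by
    have := h.trans_le hg
    have := h.trans_le hk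
    positivity
  have hlog : x * log (9 / 16 * (g * k)) = x * (log g + log k) - x * log (16 / 9) := by
    rcases hx.eq_or_lt with rfl | hpos
    · simp
    have h1 := (hpos.trans_le hg).ne'
    have h2 := (hpos.trans_le hk).ne'
    rw [log_mul (by norm_num) (mul_ne_zero h1 h2), log_mul h1 h2,
      show (9 / 16 : ℝ) = (16 / 9)⁻¹ by norm_num, log_inv]
    ring
  refine ⟨?_, fun h => eq_of_sub_le_mul_log_sub_mul_log hx hy hxy (by linarith)⟩
  have := mul_log_sub_mul_log_le hx hy hxy
  linarith

open Real in
theorem offDiagonal_term_le {x s t g : ℝ} (hx : 0 ≤ x) (hs : x ≤ s) (ht : x ≤ t) (hg : x ≤ g) :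
    x * (log s + log t + log g) - 2 * (x * log x) ≤
      x * log (16 / 9) + 2 * (3 / 4 * √(s * t * g) - x) ∧
    (x * log (16 / 9) + 2 * (3 / 4 * √(s * t * g) - x) ≤
      x * (log s + log t + log g) - 2 * (x * log x) → x = 3 / 4 * √(s * t * g)) := by
  have hy : 0 ≤ 3 / 4 * √(s * t * g) := by positivity
  have hxy : 0 < x → 0 < 3 / 4 * √(s * t * g) := fun h => by
    have := h.trans_le hs
    have := h.trans_le ht
    have := h.trans_le hg
    positivity
  have hlog : 2 * (x * log (3 / 4 * √(s * t * g))) =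
      x * (log s + log t + log g) - x * log (16 / 9) := by
    rcases hx.eq_or_lt with rfl | hpos
    · simp
    have h1 := hpos.trans_le hs
    have h2 := hpos.trans_le ht
    have h3 := hpos.trans_le hg
    have h4 : log (16 / 9) = -(2 * log (3 / 4)) := by
      rw [show (16 / 9 : ℝ) = ((3 / 4) ^ 2)⁻¹ by norm_num, log_inv, log_pow]
      norm_num
    rw [log_mul (by norm_num) (by positivity), log_sqrt (by positivity),
      log_mul (by positivity) h3.ne', log_mul h1.ne' h2.ne', h4]
    ring
  refine ⟨?_, fun h => eq_of_sub_le_mul_log_sub_mul_log hx hy hxy (by linarith)⟩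
  have := mul_log_sub_mul_log_le hx hy hxy
  linarith

/-- Cauchy–Schwarz for `√(s t' g) + √(s' t g)`. -/
theorem sq_sqrt_add_sqrt_le {s t s' t' g : ℝ} (hs : 0 ≤ s) (ht : 0 ≤ t) (hs' : 0 ≤ s')
    (ht' : 0 ≤ t') (hg : 0 ≤ g) :
    (√(s * t' * g) + √(s' * t * g)) ^ 2 ≤ (s + t) * (s' + t') * g := by
  have h1 := Real.sq_sqrt (show 0 ≤ s * t' * g by positivity)
  have h2 := Real.sq_sqrt (show 0 ≤ s' * t * g by positivity)
  have h3 : √(s * t' * g) * √(s' * t * g) ≤ (s * s' + t * t') / 2 * g := by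
    rw [← Real.sqrt_mul (by positivity)]
    refine Real.sqrt_le_iff.2 ⟨by positivity, ?_⟩
    nlinarith [mul_nonneg (sq_nonneg g) (sq_nonneg (s * s' - t * t'))]
  nlinarith

/-- If `Qᵢ² ≤ vᵢ gᵢ` then `(∑ Qᵢ)² ≤ (∑ vᵢ) (∑ gᵢ)`. -/
theorem sq_add_add_le_of_sq_le {Q R S u v w g k l : ℝ}
    (hu : 0 ≤ u) (hv : 0 ≤ v) (hw : 0 ≤ w) (hg : 0 ≤ g) (hk : 0 ≤ k) (hl : 0 ≤ l)
    (h1 : Q ^ 2 ≤ u * g) (h2 : R ^ 2 ≤ v * k) (h3 : S ^ 2 ≤ w * l) :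
    (Q + R + S) ^ 2 ≤ (u + v + w) * (g + k + l) := by
  have key : ∀ {Q R u v g k : ℝ}, 0 ≤ u → 0 ≤ v → 0 ≤ g → 0 ≤ k → Q ^ 2 ≤ u * g →
      R ^ 2 ≤ v * k → 2 * (Q * R) ≤ u * k + v * g := by
    intro Q R u v g k hu hv hg hk h1 h2
    refine le_of_abs_le <| abs_le_of_sq_le_sq ?_ (by positivity)
    have := mul_le_mul h1 h2 (sq_nonneg R) (by positivity)
    nlinarith [sq_nonneg (u * k - v * g)]
  have h12 := key hu hv hg hk h1 h2
  have h13 := key hu hw hg hl h1 h3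
  have h23 := key hv hw hk hl h2 h3
  nlinarith

open Real in
/-- The sum of the six square roots is controlled by `s`, where `∑ γ = 1 + s` and
`∑ (σ + τ) = 2 (1 - s)`. -/
theorem sum_sqrt_le {σ₁ σ₂ σ₃ τ₁ τ₂ τ₃ γ₁ γ₂ γ₃ s : ℝ} (hσ₁ : 0 ≤ σ₁) (hσ₂ : 0 ≤ σ₂)
    (hσ₃ : 0 ≤ σ₃) (hτ₁ : 0 ≤ τ₁) (hτ₂ : 0 ≤ τ₂) (hτ₃ : 0 ≤ τ₃) (hγ₁ : 0 ≤ γ₁) (hγ₂ : 0 ≤ γ₂)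
    (hγ₃ : 0 ≤ γ₃) (hs0 : 0 ≤ s) (hs1 : 0 ≤ 1 - s) (hγ : γ₁ + γ₂ + γ₃ = 1 + s)
    (hw : (σ₁ + τ₁) + (σ₂ + τ₂) + (σ₃ + τ₃) = 2 * (1 - s)) :
    √(σ₁ * τ₂ * γ₃) + √(σ₂ * τ₁ * γ₃) + (√(σ₁ * τ₃ * γ₂) + √(σ₃ * τ₁ * γ₂)) +
      (√(σ₂ * τ₃ * γ₁) + √(σ₃ * τ₂ * γ₁)) ≤ (1 - s) * (7 + 3 * s) / 6 := by
  have h3 := sq_sqrt_add_sqrt_le hσ₁ hτ₁ hσ₂ hτ₂ hγ₃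
  have h2 := sq_sqrt_add_sqrt_le hσ₁ hτ₁ hσ₃ hτ₃ hγ₂
  have h1 := sq_sqrt_add_sqrt_le hσ₂ hτ₂ hσ₃ hτ₃ hγ₁
  have h := sq_add_add_le_of_sq_le (by positivity) (by positivity) (by positivity)
    hγ₃ hγ₂ hγ₁ h3 h2 h1
  have hww : (σ₁ + τ₁) * (σ₂ + τ₂) + (σ₁ + τ₁) * (σ₃ + τ₃) + (σ₂ + τ₂) * (σ₃ + τ₃) ≤
      4 / 3 * (1 - s) ^ 2 := by
    rw [show (1 - s) ^ 2 = ((σ₁ + τ₁) + (σ₂ + τ₂) + (σ₃ + τ₃)) ^ 2 / 4 by rw [hw]; ring]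
    linarith [sq_nonneg ((σ₁ + τ₁) - (σ₂ + τ₂)), sq_nonneg ((σ₁ + τ₁) - (σ₃ + τ₃)),
      sq_nonneg ((σ₂ + τ₂) - (σ₃ + τ₃))]
  refine le_of_abs_le <| abs_le_of_sq_le_sq (h.trans ?_) (by positivity)
  rw [show γ₃ + γ₂ + γ₁ = 1 + s by linarith]
  refine (mul_le_mul_of_nonneg_right hww (by positivity)).trans ?_
  linarith [mul_nonneg (sq_nonneg (1 - s)) (sq_nonneg (1 - 3 * s))]

theorem mul_add_mul_add_mul_le (a b c : ℝ) :
    a * b + a * c + b * c ≤ (a + b + c) ^ 2 / 3 := by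
  linarith [sq_nonneg (a - b), sq_nonneg (a - c), sq_nonneg (b - c)]

/-- The equality case of `mul_add_mul_add_mul_le`. -/
theorem eq_and_eq_of_le_mul_add_mul_add_mul {a b c : ℝ}
    (h : (a + b + c) ^ 2 / 3 ≤ a * b + a * c + b * c) : a = b ∧ a = c := by
  constructor <;> refine sub_eq_zero.1 ((pow_eq_zero_iff two_ne_zero).1
    (le_antisymm ?_ (sq_nonneg _))) <;>
  linarith [sq_nonneg (a - b), sq_nonneg (a - c), sq_nonneg (b - c)]

/-- The off-diagonal critical equations force all entries to be `1 / 9`. -/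
theorem eq_ninth_of_offDiagonal_eqs {x12 x13 x21 x23 x31 x32 : ℝ}
    (h1 : x23 + x32 = 2 / 9) (h2 : x13 + x31 = 2 / 9) (h3 : x12 + x21 = 2 / 9)
    (h12 : 4 * x12 ^ 2 = (x12 + x13) * (x12 + x32)) (h21 : 4 * x21 ^ 2 = (x21 + x23) * (x21 + x31))
    (h13 : 4 * x13 ^ 2 = (x12 + x13) * (x13 + x23)) (h31 : 4 * x31 ^ 2 = (x31 + x32) * (x21 + x31))
    (h23 : 4 * x23 ^ 2 = (x21 + x23) * (x13 + x23))
    (h32 : 4 * x32 ^ 2 = (x31 + x32) * (x12 + x32)) :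
    x12 = 1 / 9 ∧ x13 = 1 / 9 ∧ x21 = 1 / 9 ∧ x23 = 1 / 9 ∧ x31 = 1 / 9 ∧ x32 = 1 / 9 := by
  obtain ⟨p, rfl⟩ : ∃ p, x12 = 1 / 9 + p := ⟨x12 - 1 / 9, by ring⟩
  obtain ⟨q, rfl⟩ : ∃ q, x23 = 1 / 9 + q := ⟨x23 - 1 / 9, by ring⟩
  obtain ⟨r, rfl⟩ : ∃ r, x31 = 1 / 9 + r := ⟨x31 - 1 / 9, by ring⟩
  obtain rfl : x21 = 1 / 9 - p := by linarith
  obtain rfl : x32 = 1 / 9 - q := by linarith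
  obtain rfl : x13 = 1 / 9 - r := by linarith
  have hpqr : p ^ 2 + q ^ 2 + r ^ 2 ≤ 0 := by
    linarith [sq_nonneg (p + q + r), sq_nonneg p, sq_nonneg q, sq_nonneg r]
  obtain rfl : p = 0 := (pow_eq_zero_iff two_ne_zero).1
    (le_antisymm (by linarith [sq_nonneg q, sq_nonneg r]) (sq_nonneg p))
  obtain rfl : q = 0 := (pow_eq_zero_iff two_ne_zero).1
    (le_antisymm (by linarith [sq_nonneg r]) (sq_nonneg q))
  obtain rfl : r = 0 := (pow_eq_zero_iff two_ne_zero).1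
    (le_antisymm (by linarith) (sq_nonneg r))
  norm_num

set_option maxHeartbeats 1000000 in
open Real in
/-- A point where `2 φ ≥ log (16 / 9)` has all its coordinates equal to `1 / 9`. -/
theorem eq_ninth_of_log_le {x11 x12 x13 x21 x22 x23 x31 x32 x33 σ₁ σ₂ σ₃ τ₁ τ₂ τ₃ γ₁ γ₂ γ₃ : ℝ}
    (h11 : 0 ≤ x11) (h12 : 0 ≤ x12) (h13 : 0 ≤ x13) (h21 : 0 ≤ x21) (h22 : 0 ≤ x22)
    (h23 : 0 ≤ x23) (h31 : 0 ≤ x31) (h32 : 0 ≤ x32) (h33 : 0 ≤ x33)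
    (hsum : x11 + x12 + x13 + x21 + x22 + x23 + x31 + x32 + x33 = 1)
    (hσ₁ : σ₁ = x12 + x13) (hτ₁ : τ₁ = x21 + x31)
    (hγ₁ : γ₁ = x22 + x23 + x32 + x33)
    (hσ₂ : σ₂ = x21 + x23) (hτ₂ : τ₂ = x12 + x32)
    (hγ₂ : γ₂ = x11 + x13 + x31 + x33)
    (hσ₃ : σ₃ = x31 + x32) (hτ₃ : τ₃ = x13 + x23)
    (hγ₃ : γ₃ = x11 + x12 + x21 + x22)
    (hL : log (16 / 9) ≤
      ((σ₁ * log σ₁ + τ₁ * log τ₁ + γ₁ * log γ₁ - x11 * log x11)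
         + (σ₂ * log σ₂ + τ₂ * log τ₂ + γ₂ * log γ₂ - x22 * log x22)
         + (σ₃ * log σ₃ + τ₃ * log τ₃ + γ₃ * log γ₃ - x33 * log x33)) -
        2 * (x12 * log x12 + x21 * log x21 + x13 * log x13 +
          x31 * log x31 + x23 * log x23 + x32 * log x32)) :
    x11 = 1 / 9 ∧ x12 = 1 / 9 ∧ x13 = 1 / 9 ∧ x21 = 1 / 9 ∧ x22 = 1 / 9 ∧
    x23 = 1 / 9 ∧ x31 = 1 / 9 ∧ x32 = 1 / 9 ∧ x33 = 1 / 9 := by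
  obtain ⟨d1, d1'⟩ := diagonal_term_le h11 (show x11 ≤ γ₂ by linarith)
    (show x11 ≤ γ₃ by linarith)
  obtain ⟨d2, d2'⟩ := diagonal_term_le h22 (show x22 ≤ γ₁ by linarith)
    (show x22 ≤ γ₃ by linarith)
  obtain ⟨d3, d3'⟩ := diagonal_term_le h33 (show x33 ≤ γ₁ by linarith)
    (show x33 ≤ γ₂ by linarith)
  obtain ⟨o12, o12'⟩ := offDiagonal_term_le h12 (show x12 ≤ σ₁ by linarith)
    (show x12 ≤ τ₂ by linarith) (show x12 ≤ γ₃ by linarith)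
  obtain ⟨o21, o21'⟩ := offDiagonal_term_le h21 (show x21 ≤ σ₂ by linarith)
    (show x21 ≤ τ₁ by linarith) (show x21 ≤ γ₃ by linarith)
  obtain ⟨o13, o13'⟩ := offDiagonal_term_le h13 (show x13 ≤ σ₁ by linarith)
    (show x13 ≤ τ₃ by linarith) (show x13 ≤ γ₂ by linarith)
  obtain ⟨o31, o31'⟩ := offDiagonal_term_le h31 (show x31 ≤ σ₃ by linarith)
    (show x31 ≤ τ₁ by linarith) (show x31 ≤ γ₂ by linarith)
  obtain ⟨o23, o23'⟩ := offDiagonal_term_le h23 (show x23 ≤ σ₂ by linarith)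
    (show x23 ≤ τ₃ by linarith) (show x23 ≤ γ₁ by linarith)
  obtain ⟨o32, o32'⟩ := offDiagonal_term_le h32 (show x32 ≤ σ₃ by linarith)
    (show x32 ≤ τ₂ by linarith) (show x32 ≤ γ₁ by linarith)
  have hσ1_nonneg : 0 ≤ σ₁ := by linarith
  have hτ1_nonneg : 0 ≤ τ₁ := by linarith
  have hγ1_nonneg : 0 ≤ γ₁ := by linarith
  have hσ2_nonneg : 0 ≤ σ₂ := by linarith
  have hτ2_nonneg : 0 ≤ τ₂ := by linarith
  have hγ2_nonneg : 0 ≤ γ₂ := by linarith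
  have hσ3_nonneg : 0 ≤ σ₃ := by linarith
  have hτ3_nonneg : 0 ≤ τ₃ := by linarith
  have hγ3_nonneg : 0 ≤ γ₃ := by linarith
  obtain ⟨s, hs⟩ : ∃ s, s = x11 + x22 + x33 := ⟨_, rfl⟩
  have hγ : γ₁ + γ₂ + γ₃ = 1 + s := by linarith
  have hγγ := mul_add_mul_add_mul_le γ₁ γ₂ γ₃
  have hγγ' := eq_and_eq_of_le_mul_add_mul_add_mul (a := γ₁) (b := γ₂) (c := γ₃)
  have hq := sum_sqrt_le hσ1_nonneg hσ2_nonneg hσ3_nonneg hτ1_nonneg hτ2_nonneg hτ3_nonneg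
    hγ1_nonneg hγ2_nonneg hγ3_nonneg (by linarith) (by linarith) hγ (by linarith)
  rw [hγ] at hγγ hγγ'
  have r12 := Real.sq_sqrt (show 0 ≤ σ₁ * τ₂ * γ₃ by positivity)
  have r21 := Real.sq_sqrt (show 0 ≤ σ₂ * τ₁ * γ₃ by positivity)
  have r13 := Real.sq_sqrt (show 0 ≤ σ₁ * τ₃ * γ₂ by positivity)
  have r31 := Real.sq_sqrt (show 0 ≤ σ₃ * τ₁ * γ₂ by positivity)
  have r23 := Real.sq_sqrt (show 0 ≤ σ₂ * τ₃ * γ₁ by positivity)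
  have r32 := Real.sq_sqrt (show 0 ≤ σ₃ * τ₂ * γ₁ by positivity)
  generalize √(σ₁ * τ₂ * γ₃) = q12 at *
  generalize √(σ₂ * τ₁ * γ₃) = q21 at *
  generalize √(σ₁ * τ₃ * γ₂) = q13 at *
  generalize √(σ₃ * τ₁ * γ₂) = q31 at *
  generalize √(σ₂ * τ₃ * γ₁) = q23 at *
  generalize √(σ₃ * τ₂ * γ₁) = q32 at *
  have hlog : log (16 / 9) * (x11 + x12 + x13 + x21 + x22 + x23 + x31 + x32 + x33) =
      log (16 / 9) := by rw [hsum, mul_one]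
  have eσ₁ : σ₁ * log σ₁ = (x12 + x13) * log σ₁ := by rw [← hσ₁]
  have eτ₁ : τ₁ * log τ₁ = (x21 + x31) * log τ₁ := by rw [← hτ₁]
  have eγ₁ : γ₁ * log γ₁ = (x22 + x23 + x32 + x33) * log γ₁ := by rw [← hγ₁]
  have eσ₂ : σ₂ * log σ₂ = (x21 + x23) * log σ₂ := by rw [← hσ₂]
  have eτ₂ : τ₂ * log τ₂ = (x12 + x32) * log τ₂ := by rw [← hτ₂]
  have eγ₂ : γ₂ * log γ₂ = (x11 + x13 + x31 + x33) * log γ₂ := by rw [← hγ₂]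
  have eσ₃ : σ₃ * log σ₃ = (x31 + x32) * log σ₃ := by rw [← hσ₃]
  have eτ₃ : τ₃ * log τ₃ = (x13 + x23) * log τ₃ := by rw [← hτ₃]
  have eγ₃ : γ₃ * log γ₃ = (x11 + x12 + x21 + x22) * log γ₃ := by rw [← hγ₃]
  rw [eσ₁, eσ₂, eσ₃, eτ₁, eτ₂, eτ₃, eγ₁, eγ₂, eγ₃] at hL
  have hs3 : s = 1 / 3 := by
    have : (1 - 3 * s) ^ 2 ≤ 0 := by
      linarith only [hL, hlog, hsum, hs, hγγ, hq, d1, d2, d3,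
        o12, o21, o13, o31, o23, o32]
    linarith [(pow_eq_zero_iff two_ne_zero).1 (this.antisymm (sq_nonneg _))]
  rw [hs3] at hs hγ hγγ hγγ' hq
  obtain ⟨⟨g12, g13⟩, d1'', d2'', d3'', o12'', o21'', o13'', o31'', o23'', o32''⟩ :
      (γ₁ = γ₂ ∧ γ₁ = γ₃) ∧ x11 = 9 / 16 * (γ₂ * γ₃) ∧ x22 = 9 / 16 * (γ₁ * γ₃) ∧
      x33 = 9 / 16 * (γ₁ * γ₂) ∧ x12 = 3 / 4 * q12 ∧ x21 = 3 / 4 * q21 ∧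
      x13 = 3 / 4 * q13 ∧ x31 = 3 / 4 * q31 ∧ x23 = 3 / 4 * q23 ∧ x32 = 3 / 4 * q32 := by
    refine ⟨hγγ' ?_, d1' ?_, d2' ?_, d3' ?_, o12' ?_, o21' ?_, o13' ?_, o31' ?_, o23' ?_,
      o32' ?_⟩ <;>
    linarith only [hL, hlog, hsum, hs, hγγ, hq, d1, d2, d3, o12, o21, o13, o31, o23, o32]
  have g1 : γ₁ = 4 / 9 := by linarith
  have g2 : γ₂ = 4 / 9 := by linarith
  have g3 : γ₃ = 4 / 9 := by linarith
  rw [g1, g2] at d3''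
  rw [g1, g3] at d2''
  rw [g2, g3] at d1''
  have s12 : 4 * x12 ^ 2 = (x12 + x13) * (x12 + x32) := by
    rw [← hσ₁, ← hτ₂, o12'', mul_pow, r12, g3]
    ring
  have s21 : 4 * x21 ^ 2 = (x21 + x23) * (x21 + x31) := by
    rw [← hσ₂, ← hτ₁, o21'', mul_pow, r21, g3]
    ring
  have s13 : 4 * x13 ^ 2 = (x12 + x13) * (x13 + x23) := by
    rw [← hσ₁, ← hτ₃, o13'', mul_pow, r13, g2]
    ring
  have s31 : 4 * x31 ^ 2 = (x31 + x32) * (x21 + x31) := by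
    rw [← hσ₃, ← hτ₁, o31'', mul_pow, r31, g2]
    ring
  have s23 : 4 * x23 ^ 2 = (x21 + x23) * (x13 + x23) := by
    rw [← hσ₂, ← hτ₃, o23'', mul_pow, r23, g1]
    ring
  have s32 : 4 * x32 ^ 2 = (x31 + x32) * (x12 + x32) := by
    rw [← hσ₃, ← hτ₂, o32'', mul_pow, r32, g1]
    ring
  obtain ⟨y12, y13, y21, y23, y31, y32⟩ := eq_ninth_of_offDiagonal_eqs
    (by linarith) (by linarith) (by linarith) s12 s21 s13 s31 s23 s32
  refine ⟨?_, y12, y13, y21, ?_, y23, y31, y32, ?_⟩ <;> linarith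

open Classical in
/-- On `Σ₉ = {x = (x_{ef})_{e,f∈{1,2,3}} ∈ [0,1]⁹ : ∑ x_{ef} = 1}`, with
`σ_e = ∑_{f≠e} x_{ef}`, `τ_e = ∑_{f≠e} x_{fe}`, `γ_e = ∑_{f≠e,f'≠e} x_{ff'}`, the function
`φ(x) = (1/2)∑_e [σ_e ln σ_e + τ_e ln τ_e + γ_e ln γ_e − x_{ee} ln x_{ee}
− 2∑_{f≠e} x_{ef} ln x_{ef}]` attains its maximum at the unique point `x_{ef} ≡ 1/9`,
and the maximum value is `ln(4/3)`. -/
theorem stmt_10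
    (σ τ γ : (Fin 3 → Fin 3 → ℝ) → Fin 3 → ℝ)
    (hσ : ∀ x e, σ x e = ∑ f, if f ≠ e then x e f else 0)
    (hτ : ∀ x e, τ x e = ∑ f, if f ≠ e then x f e else 0)
    (hγ : ∀ x e, γ x e = ∑ f, ∑ f', if f ≠ e ∧ f' ≠ e then x f f' else 0)
    (φ : (Fin 3 → Fin 3 → ℝ) → ℝ)
    (hφ : ∀ x, φ x = (1/2) * ∑ e,
      (σ x e * Real.log (σ x e) + τ x e * Real.log (τ x e) +
        γ x e * Real.log (γ x e) - x e e * Real.log (x e e) -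
        2 * ∑ f, if f ≠ e then x e f * Real.log (x e f) else 0)) :
    (∀ x : Fin 3 → Fin 3 → ℝ, (∀ e f, x e f ∈ Set.Icc (0:ℝ) 1) →
        (∑ e, ∑ f, x e f) = 1 →
        x ≠ (fun _ _ => 1/9) → φ x < φ (fun _ _ => 1/9)) ∧
    φ (fun _ _ => 1/9) = Real.log (4/3) := by
  have hval : φ (fun _ _ => 1 / 9) = Real.log (4 / 3) := by
    rw [hφ]
    simp only [hσ, hτ, hγ, Fin.sum_univ_three]
    norm_num [Fin.ext_iff]
    have h2 : Real.log (2 / 9) = Real.log 2 - Real.log 9 :=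
      Real.log_div (by norm_num) (by norm_num)
    have h1 : Real.log (1 / 9) = -Real.log 9 := by rw [one_div, Real.log_inv]
    have h4 : Real.log 4 = 2 * Real.log 2 := by
      rw [show (4 : ℝ) = 2 ^ 2 by norm_num, Real.log_pow]; norm_num
    have h9 : Real.log 9 = 2 * Real.log 3 := by
      rw [show (9 : ℝ) = 3 ^ 2 by norm_num, Real.log_pow]; norm_num
    rw [Real.log_div (x := 4) (y := 9) (by norm_num) (by norm_num),
      Real.log_div (x := 4) (y := 3) (by norm_num) (by norm_num), h2, h1, h4, h9]
    ring
  refine ⟨fun x hx hsum hne => ?_, hval⟩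
  rw [hval]
  by_contra! hle
  refine hne ?_
  have hlog : Real.log (16 / 9) = 2 * Real.log (4 / 3) := by
    rw [show (16 / 9 : ℝ) = (4 / 3) ^ 2 by norm_num, Real.log_pow]
    norm_num
  have hnn : ∀ e f, 0 ≤ x e f := fun e f => (hx e f).1
  rw [hφ] at hle
  simp only [Fin.sum_univ_three] at hsum hle
  obtain ⟨h00, h01, h02, h10, h11, h12, h20, h21, h22⟩ := eq_ninth_of_log_le
    (hnn 0 0) (hnn 0 1) (hnn 0 2) (hnn 1 0) (hnn 1 1) (hnn 1 2) (hnn 2 0) (hnn 2 1) (hnn 2 2)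
    (by linarith)
    (σ₁ := σ x 0) (by simp [hσ, Fin.sum_univ_three])
    (τ₁ := τ x 0) (by simp [hτ, Fin.sum_univ_three])
    (γ₁ := γ x 0) (by simp [hγ, Fin.sum_univ_three]; ring)
    (σ₂ := σ x 1) (by simp [hσ, Fin.sum_univ_three])
    (τ₂ := τ x 1) (by simp [hτ, Fin.sum_univ_three])
    (γ₂ := γ x 1) (by simp [hγ, Fin.sum_univ_three]; ring)
    (σ₃ := σ x 2) (by simp [hσ, Fin.sum_univ_three])
    (τ₃ := τ x 2) (by simp [hτ, Fin.sum_univ_three])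
    (γ₃ := γ x 2) (by simp [hγ, Fin.sum_univ_three]; ring)
    (by
      simp [Fin.ext_iff] at hle
      linarith)
  funext e f
  fin_cases e <;> fin_cases f <;> assumption
end

section
/- Let G be a finite connected non-bipartite d-regular simple graph with g vertices and h = dg/2 edges, d ≥ 3, with adjacency matrix A having eigenvalues α₁,…,α_g. With I = {(i,e,f) : i ∈ V(G), e, f edges incident to i} and V* ⊆ ℝ^I the subspace of vectors (z_{ief}) such that for every edge e with endpoints i and j: z_{iee} = z_{jee}, Σ_{f ∋ i} z_{ief} = Σ_{f ∋ j} z_{jef}, and Σ_{f ∋ i} z_{ife} = Σ_{f ∋ j} z_{jfe}, the lattice L² = {ν ∈ V* ∩ ℤ^I : Σ_{e,f ∋ i} ν_{ief} = 0 for every i} has rank d²g − g − 3dg/2, and its determinant is Vol(L²) = 2^{3h/2 − 3g/2 − 2} (d(d−2))^{h/2 − g/2} Π_{i=1}^g (d + α_i)(d(2d−3) − α_i)^{1/2}. -/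
namespace Matrix

section IntegerKernel

/-- For rectangular matrices that are square up to reindexing, `det (X Uᵀ)` is a product of
determinants. -/
theorem det_mul_transpose_eq {R ι n : Type*} [CommRing R] [Fintype n] [DecidableEq n] [Fintype ι]
    (e : n ≃ ι) (X U : Matrix n ι R) :
    (X * Uᵀ).det = (X.submatrix id e).det * (U.submatrix id e).det := by
  rw [← det_transpose (U.submatrix id e), ← det_mul, transpose_submatrix,
    submatrix_mul_equiv, submatrix_id_id]

variable {κ ι : Type*} [Fintype ι]

/-- If the image of an integer matrix has finite index `q`, it has preimages of a basis of its
image, and together with the kernel they generate. -/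
theorem exists_section_of_index_range [Fintype κ] [DecidableEq κ]
    (M : Matrix κ ι ℤ) {q : ℕ} (hq : q ≠ 0)
    (hM : (LinearMap.range M.mulVecLin).toAddSubgroup.index = q) :
    ∃ c : Matrix κ ι ℤ, (M * cᵀ).det.natAbs = q ∧
      ∀ x, ∃ a : κ → ℤ, M *ᵥ (x - a ᵥ* c) = 0 := by
  have hcard : Nat.card ((κ → ℤ) ⧸ LinearMap.range M.mulVecLin) = q := hM
  have hfin : Finite ((κ → ℤ) ⧸ LinearMap.range M.mulVecLin) :=
    Nat.finite_of_card_ne_zero (by rwa [hcard])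
  have hrank := (Submodule.finiteQuotient_iff _).1 hfin
  rw [Module.finrank_fintype_fun_eq_card] at hrank
  let bN : Module.Basis κ ℤ (LinearMap.range M.mulVecLin) :=
    (Module.finBasis ℤ _).reindex (Fintype.equivOfCardEq (by simpa using hrank))
  choose c hc using fun k => (bN k).2
  refine ⟨of c, ?_, fun x => ?_⟩
  · have h := Submodule.natAbs_det_basis_change (Pi.basisFun ℤ κ) _ bN
    rw [hcard] at h
    rw [← h, Module.Basis.det_apply]
    congr 2
    ext i k
    have := congrFun (hc k) i
    simpa [Module.Basis.toMatrix, Matrix.mul_apply, Matrix.mulVec, dotProduct] using this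
  · have hx : M *ᵥ x ∈ LinearMap.range M.mulVecLin := LinearMap.mem_range_self M.mulVecLin x
    have h := congrArg Subtype.val (bN.sum_repr ⟨_, hx⟩)
    simp only [Submodule.coe_sum, Submodule.coe_smul, ← hc] at h
    refine ⟨fun k => bN.repr ⟨_, hx⟩ k, ?_⟩
    rw [mulVec_sub, sub_eq_zero, vecMul_eq_sum, mulVec_sum]
    simp only [mulVec_smul]
    exact h.symm

/-- If the image of an integer matrix has finite index `q`, then any basis `b` of its kernel lattice
satisfies `det (b bᵀ) * q ^ 2 = det (M Mᵀ)`. -/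
theorem det_ker_basis_of_index_range [Fintype κ] [DecidableEq κ] [DecidableEq ι]
    (M : Matrix κ ι ℤ) {q : ℕ} (hq : q ≠ 0)
    (hM : (LinearMap.range M.mulVecLin).toAddSubgroup.index = q)
    {m : ℕ} (b : Matrix (Fin m) ι ℤ) (hb : LinearIndependent ℤ b.row)
    (hker : ∀ x, M *ᵥ x = 0 ↔ ∃ a : Fin m → ℤ, x = a ᵥ* b) :
    m + Fintype.card κ = Fintype.card ι ∧ (b * bᵀ).det * (q : ℤ) ^ 2 = (M * Mᵀ).det ∧
      (b * bᵀ).det ≠ 0 := by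
  obtain ⟨c, hc, hgen⟩ := exists_section_of_index_range M hq hM
  have hMb : M * bᵀ = 0 := by
    ext k j
    have := congrFun ((hker (b.row j)).2 ⟨Pi.single j 1, by simp⟩) k
    simpa [Matrix.mul_apply, Matrix.mulVec, dotProduct] using this
  have hdet0 : (M * cᵀ).det ≠ 0 := by
    intro h
    rw [h] at hc
    exact hq hc.symm
  let U : Matrix (Fin m ⊕ κ) ι ℤ := fromRows b c
  have hvec : ∀ g : Fin m ⊕ κ → ℤ, g ᵥ* U = (g ∘ Sum.inl) ᵥ* b + (g ∘ Sum.inr) ᵥ* c :=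
    fun g => vecMul_fromRows _ _ _
  have hbinj : ∀ g : Fin m → ℤ, g ᵥ* b = 0 → g = 0 := by
    intro g hg
    rw [vecMul_eq_sum] at hg
    exact funext (Fintype.linearIndependent_iff.1 hb g hg)
  have hUli : LinearIndependent ℤ U.row := by
    rw [Fintype.linearIndependent_iff]
    intro g hg
    have hg' : g ᵥ* U = 0 := by rw [vecMul_eq_sum]; exact hg
    rw [hvec] at hg'
    have h2 : (g ∘ Sum.inr) = 0 := by
      apply eq_zero_of_mulVec_eq_zero hdet0
      have := congrArg (M *ᵥ ·) hg'
      simpa [mulVec_add, ← mulVec_transpose, hMb] using this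
    have h1 : (g ∘ Sum.inl) = 0 := by
      rw [h2] at hg'
      exact hbinj _ (by simpa using hg')
    rintro (j | k)
    · exact congrFun h1 j
    · exact congrFun h2 k
  have hUspan : ⊤ ≤ Submodule.span ℤ (Set.range U.row) := by
    intro x _
    obtain ⟨a, ha⟩ := hgen x
    obtain ⟨a', ha'⟩ := (hker _).1 ha
    rw [Submodule.mem_span_range_iff_exists_fun]
    refine ⟨Sum.elim a' a, ?_⟩
    have : Sum.elim a' a ᵥ* U = x := by
      rw [hvec, Sum.elim_comp_inl, Sum.elim_comp_inr, ← ha']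
      abel
    rwa [vecMul_eq_sum] at this
  let B : Module.Basis (Fin m ⊕ κ) ℤ (ι → ℤ) := Module.Basis.mk hUli hUspan
  have hB : ∀ i, B i = U.row i := fun i => Module.Basis.mk_apply hUli hUspan i
  let e : Fin m ⊕ κ ≃ ι := B.indexEquiv (Pi.basisFun ℤ ι)
  have hUU : (U * Uᵀ).det = 1 := by
    have hunit : IsUnit ((U.submatrix id e).det) := by
      have h := (Pi.basisFun ℤ ι).isUnit_det (B.reindex e)
      rw [Module.Basis.det_apply] at h
      convert! h using 1
      rw [← det_transpose, ← det_submatrix_equiv_self e.symm]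
      congr 1
      ext i j
      simp [hB, Module.Basis.toMatrix]
    rw [det_mul_transpose_eq e]
    exact Int.isUnit_mul_self hunit
  let X : Matrix (Fin m ⊕ κ) ι ℤ := fromRows b M
  have hbM : b * Mᵀ = 0 := by
    have := congrArg transpose hMb
    simpa using this
  have hXX : (X * Xᵀ).det = (b * bᵀ).det * (M * Mᵀ).det := by
    rw [transpose_fromRows, fromRows_mul_fromCols, hMb, det_fromBlocks_zero₂₁]
  have hXU : (X * Uᵀ).det = (b * bᵀ).det * (M * cᵀ).det := by
    rw [transpose_fromRows, fromRows_mul_fromCols, hMb, det_fromBlocks_zero₂₁]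
  have hbb : (b * bᵀ).det ≠ 0 := by
    intro h
    obtain ⟨v, hv, hv0⟩ := exists_vecMul_eq_zero_iff.2 h
    refine hv (hbinj _ (dotProduct_self_eq_zero.1 ?_))
    have := congrArg (· ⬝ᵥ v) hv0
    rw [← vecMul_vecMul, vecMul_transpose] at this
    simpa [dotProduct_comm, dotProduct_mulVec] using this
  refine ⟨by simpa using Fintype.card_congr e, ?_, hbb⟩
  have hsq : (X * Uᵀ).det ^ 2 = (X * Xᵀ).det * (U * Uᵀ).det := by
    simp only [det_mul_transpose_eq e]
    ring
  rw [hUU, hXX, hXU, mul_pow, mul_one, sq (b * bᵀ).det, mul_assoc] at hsq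
  have := mul_left_cancel₀ hbb hsq
  rw [← this, ← hc, Int.natCast_natAbs, sq_abs]

/-- The integer kernel of an integer matrix has a `ℤ`-basis. -/
theorem exists_ker_basis (M : Matrix κ ι ℤ) :
    ∃ (m : ℕ) (b : Matrix (Fin m) ι ℤ), LinearIndependent ℤ b.row ∧
      ∀ x, M *ᵥ x = 0 ↔ ∃ a : Fin m → ℤ, x = a ᵥ* b := by
  let B := Module.finBasis ℤ (LinearMap.ker M.mulVecLin)
  refine ⟨_, of fun i => (B i : ι → ℤ), ?_, fun x => ⟨fun hx => ?_, ?_⟩⟩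
  · exact B.linearIndependent.map' (LinearMap.ker M.mulVecLin).subtype
      (Submodule.ker_subtype _)
  · have hx' : x ∈ LinearMap.ker M.mulVecLin := hx
    have h := congrArg Subtype.val (B.sum_repr ⟨x, hx'⟩)
    simp only [Submodule.coe_sum, Submodule.coe_smul] at h
    refine ⟨fun i => B.repr ⟨x, hx'⟩ i, ?_⟩
    rw [vecMul_eq_sum]
    exact h.symm
  · rintro ⟨a, rfl⟩
    rw [vecMul_eq_sum, mulVec_sum]
    refine Finset.sum_eq_zero fun i _ => ?_
    have : M *ᵥ (B i : ι → ℤ) = 0 := (B i).2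
    rw [mulVec_smul]
    change a i • M *ᵥ (B i : ι → ℤ) = 0
    rw [this, smul_zero]

end IntegerKernel

section ConstraintGram

theorem det_smul_one_add_mul_comm_of_le {m n R : Type*} [CommRing R] [Fintype m] [DecidableEq m]
    [Fintype n] [DecidableEq n] (A : Matrix m n R) (B : Matrix n m R)
    (hle : Fintype.card n ≤ Fintype.card m) (t : R) :
    (t • 1 + A * B).det = t ^ (Fintype.card m - Fintype.card n) * (t • 1 + B * A).det := by
  have h := congrArg (Polynomial.eval t) (charpoly_mul_comm_of_le (-A) B hle)
  simpa [eval_charpoly, smul_one_eq_diagonal] using h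

variable {V E : Type*} [Fintype V] [DecidableEq V] [Fintype E] [DecidableEq E]

/-- The Gram matrix, in terms of the signed incidence matrix `N`, of the four families of linear
forms defining the lattice. -/
def constraintGram {R : Type*} [CommRing R] (N : Matrix V E R) (d : R) :
    Matrix ((E ⊕ E) ⊕ (E ⊕ V)) ((E ⊕ E) ⊕ (E ⊕ V)) R :=
  fromBlocks
    (fromBlocks ((2 : R) • 1) ((2 : R) • 1) ((2 : R) • 1) ((2 * d) • 1))
    (fromBlocks ((2 : R) • 1) Nᵀ (Nᵀ * N) (d • Nᵀ))
    (fromBlocks ((2 : R) • 1) (Nᵀ * N) N (d • N))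
    (fromBlocks ((2 * d) • 1) (d • Nᵀ) (d • N) (d ^ 2 • 1))

theorem det_constraintGram_aux (N : Matrix V E ℝ) (d : ℝ) :
    (constraintGram N d).det = ((2 * d) • 1 - Nᵀ * N).det *
      (fromBlocks ((2 : ℝ) • ((2 * d - 4) • 1 + Nᵀ * N)) ((2 * (d - 1)) • Nᵀ)
        ((2 * (d - 1)) • N) (d ^ 2 • 1 - (1 / 2 : ℝ) • (N * Nᵀ))).det := by
  let U : Matrix ((E ⊕ E) ⊕ (E ⊕ V)) ((E ⊕ E) ⊕ (E ⊕ V)) ℝ :=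
    fromBlocks 1 (fromBlocks 0 0 (-1) 0) (fromBlocks ((-2 : ℝ) • 1) 1 ((-1 / 2 : ℝ) • N) 0) 1
  have hU : U.det = 2 ^ Fintype.card E := by
    have h : (1 : Matrix (E ⊕ V) (E ⊕ V) ℝ) -
        (fromBlocks ((-2 : ℝ) • 1) 1 ((-1 / 2 : ℝ) • N) 0 : Matrix (E ⊕ V) (E ⊕ E) ℝ) *
          (fromBlocks 0 0 (-1) 0 : Matrix (E ⊕ E) (E ⊕ V) ℝ) = fromBlocks ((2 : ℝ) • 1) 0 0 1 := by
      rw [sub_eq_iff_eq_add, fromBlocks_multiply, fromBlocks_add, ← fromBlocks_one]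
      simp only [Matrix.mul_zero, Matrix.mul_neg, Matrix.mul_one, neg_zero, add_zero,
        zero_add]
      congr 1
      module
    rw [det_fromBlocks_one₁₁, h, det_fromBlocks_zero₂₁, det_one, mul_one, det_smul, det_one,
      mul_one]
  have hmul : U * constraintGram N d * Uᵀ =
      fromBlocks (fromBlocks ((2 : ℝ) • 1) 0 0 ((2 : ℝ) • ((2 * d) • 1 - Nᵀ * N))) 0 0
        (fromBlocks ((2 : ℝ) • ((2 * d - 4) • 1 + Nᵀ * N)) ((2 * (d - 1)) • Nᵀ)
          ((2 * (d - 1)) • N) (d ^ 2 • 1 - (1 / 2 : ℝ) • (N * Nᵀ))) := by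
    simp only [U, constraintGram, ← fromBlocks_one, fromBlocks_transpose, fromBlocks_multiply,
      fromBlocks_add, transpose_one, transpose_zero, transpose_neg, transpose_smul,
      Matrix.mul_zero, Matrix.zero_mul, Matrix.one_mul, Matrix.mul_one, Matrix.smul_mul,
      Matrix.mul_smul, Matrix.neg_mul, Matrix.mul_neg, add_zero, zero_add, Matrix.add_mul]
    rw [← fromBlocks_zero, ← fromBlocks_zero]
    congr 2 <;> module
  have h := congrArg det hmul
  rw [det_mul, det_mul, det_transpose, hU, det_fromBlocks_zero₂₁, det_fromBlocks_zero₂₁,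
    det_smul, det_smul, det_one] at h
  have h2 : (2 : ℝ) ^ Fintype.card E * 2 ^ Fintype.card E ≠ 0 := by positivity
  apply mul_left_cancel₀ h2
  linear_combination h

/-- Evaluation of the determinant of `constraintGram` through the Laplacian `N * Nᵀ`. -/
theorem det_constraintGram (N : Matrix V E ℝ) {d : ℝ} (hd : 2 < d)
    (hle : Fintype.card V ≤ Fintype.card E) :
    (constraintGram N d).det =
      2 ^ Fintype.card E * ((2 * d) * (2 * d - 4)) ^ (Fintype.card E - Fintype.card V) *
        ((1 / 2 : ℝ) ^ Fintype.card V * (((2 * d) • 1 - N * Nᵀ).det ^ 2 *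
          ((2 * d * (d - 2)) • 1 + N * Nᵀ).det)) := by
  have hpos : ((2 * d - 4) • 1 + N * Nᵀ).det ≠ 0 := by
    have h1 : (N * Nᵀ).PosSemidef := by
      simpa using posSemidef_self_mul_conjTranspose N
    have h2 : ((2 * d - 4) • (1 : Matrix V V ℝ)).PosDef := PosDef.one.smul (by linarith)
    exact (h2.add_posSemidef h1).det_pos.ne'
  have hlast : (fromBlocks ((2 : ℝ) • ((2 * d - 4) • 1 + Nᵀ * N)) ((2 * (d - 1)) • Nᵀ)
        ((2 * (d - 1)) • N) (d ^ 2 • 1 - (1 / 2 : ℝ) • (N * Nᵀ))).det =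
      2 ^ Fintype.card E * (2 * d - 4) ^ (Fintype.card E - Fintype.card V) *
        ((1 / 2 : ℝ) • (((2 * d) • 1 - N * Nᵀ) * ((2 * d * (d - 2)) • 1 + N * Nᵀ))).det := by
    have hmul : fromBlocks ((2 : ℝ) • ((2 * d - 4) • 1 + Nᵀ * N)) ((2 * (d - 1)) • Nᵀ)
        ((2 * (d - 1)) • N) (d ^ 2 • 1 - (1 / 2 : ℝ) • (N * Nᵀ)) *
        fromBlocks 1 (-(d - 1) • Nᵀ) 0 ((2 * d - 4) • 1 + N * Nᵀ) =
        fromBlocks ((2 : ℝ) • ((2 * d - 4) • 1 + Nᵀ * N)) 0 ((2 * (d - 1)) • N)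
          ((1 / 2 : ℝ) • (((2 * d) • 1 - N * Nᵀ) * ((2 * d * (d - 2)) • 1 + N * Nᵀ))) := by
      rw [fromBlocks_multiply]
      simp only [Matrix.mul_zero, Matrix.mul_one, Matrix.one_mul, Matrix.smul_mul,
        Matrix.mul_smul, add_zero, Matrix.add_mul, Matrix.sub_mul, Matrix.mul_add, Matrix.mul_assoc]
      congr 1 <;> module
    have h := congrArg det hmul
    rw [det_mul, det_fromBlocks_zero₂₁, det_fromBlocks_zero₁₂, det_one, one_mul, det_smul,
      det_smul_one_add_mul_comm_of_le _ _ hle] at h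
    apply mul_right_cancel₀ hpos
    linear_combination h
  have hfirst : ((2 * d) • 1 - Nᵀ * N).det =
      (2 * d) ^ (Fintype.card E - Fintype.card V) * ((2 * d) • 1 - N * Nᵀ).det := by
    have := det_smul_one_add_mul_comm_of_le (-Nᵀ) N hle (2 * d)
    simpa [sub_eq_add_neg] using this
  rw [det_constraintGram_aux, hlast, hfirst, det_smul, det_mul, mul_pow (2 * d)]
  ring

end ConstraintGram

section CharpolyRoots

open Polynomial

variable {n ι : Type*} [Fintype n] [DecidableEq n] [Fintype ι] {A : Matrix n n ℝ} {α : ι → ℝ}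

theorem det_smul_one_sub_eq_prod (hα : A.charpoly = ∏ i, (X - C (α i))) (t : ℝ) :
    (t • 1 - A).det = ∏ i, (t - α i) := by
  have h := congrArg (Polynomial.eval t) hα
  simpa [eval_charpoly, eval_prod, smul_one_eq_diagonal] using h

theorem det_smul_one_add_eq_prod (hα : A.charpoly = ∏ i, (X - C (α i))) (t : ℝ) :
    (t • 1 + A).det = ∏ i, (t + α i) := by
  have hcard : Fintype.card n = Fintype.card ι := by
    have h := congrArg natDegree hα
    rwa [charpoly_natDegree_eq_dim, natDegree_finsetProd_X_sub_C_eq_card, Finset.card_univ] at h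
  rw [show t • 1 + A = -((-t) • 1 - A) by module, det_neg, det_smul_one_sub_eq_prod hα, hcard,
    ← Finset.card_univ, ← Finset.prod_const, ← Finset.prod_mul_distrib]
  exact Finset.prod_congr rfl fun i _ => by ring

theorem PosSemidef.charpoly_root_le (hα : A.charpoly = ∏ i, (X - C (α i))) {c : ℝ}
    (h : (c • 1 - A).PosSemidef) (i : ι) : α i ≤ c := by
  by_contra! hlt
  have hpos : (((α i - c) • 1 : Matrix n n ℝ) + (c • 1 - A)).PosDef :=
    (PosDef.one.smul (sub_pos.2 hlt)).add_posSemidef h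
  have hdet := hpos.det_pos
  rw [show ((α i - c) • 1 : Matrix n n ℝ) + (c • 1 - A) = α i • 1 - A by module,
    det_smul_one_sub_eq_prod hα, Finset.prod_eq_zero (Finset.mem_univ i) (sub_self _)] at hdet
  exact lt_irrefl _ hdet

theorem PosSemidef.neg_le_charpoly_root (hα : A.charpoly = ∏ i, (X - C (α i))) {c : ℝ}
    (h : (c • 1 + A).PosSemidef) (i : ι) : -c ≤ α i := by
  by_contra! hlt
  have hpos : (((-α i - c) • 1 : Matrix n n ℝ) + (c • 1 + A)).PosDef :=
    (PosDef.one.smul (by linarith)).add_posSemidef h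
  have hdet := hpos.det_pos
  rw [show ((-α i - c) • 1 : Matrix n n ℝ) + (c • 1 + A) = (-α i) • 1 + A by module,
    det_smul_one_add_eq_prod hα, Finset.prod_eq_zero (Finset.mem_univ i) (neg_add_cancel _)] at hdet
  exact lt_irrefl _ hdet

end CharpolyRoots

end Matrix

namespace SimpleGraph

open Matrix

section AdjMatrix

variable {V : Type*} [Fintype V] [DecidableEq V] {G : SimpleGraph V} [DecidableRel G.Adj] {d : ℕ}

theorem IsRegularOfDegree.posSemidef_sub_adjMatrix (hreg : G.IsRegularOfDegree d) :
    ((d : ℝ) • 1 - G.adjMatrix ℝ).PosSemidef := by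
  convert! G.posSemidef_lapMatrix ℝ
  rw [lapMatrix, degMatrix, smul_one_eq_diagonal]
  congr 2
  ext i
  rw [hreg i]

theorem IsRegularOfDegree.posSemidef_add_adjMatrix (hreg : G.IsRegularOfDegree d) :
    ((d : ℝ) • 1 + G.adjMatrix ℝ).PosSemidef := by
  have h := posSemidef_self_mul_conjTranspose (G.incMatrix ℝ)
  rw [conjTranspose_eq_transpose_of_trivial, incMatrix_mul_transpose] at h
  convert! h using 1
  ext i j
  rw [Matrix.add_apply, Matrix.smul_apply, one_apply, adjMatrix_apply, of_apply]
  by_cases hij : i = j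
  · subst hij
    simpa using (hreg i).symm
  · simp [hij]

end AdjMatrix

section ConstraintMatrix

variable {V : Type*} (G : SimpleGraph V)

/-- Triples of a vertex and two edges incident to it. -/
abbrev EdgePairs : Type _ := {t : V × G.edgeSet × G.edgeSet //
  t.1 ∈ (t.2.1 : Sym2 V) ∧ t.1 ∈ (t.2.2 : Sym2 V)}

variable {G}

theorem out_fst_ne_out_snd (e : G.edgeSet) : (e : Sym2 V).out.1 ≠ (e : Sym2 V).out.2 := by
  have h : G.Adj (e : Sym2 V).out.1 (e : Sym2 V).out.2 := by
    rw [← mem_edgeSet, Sym2.mk, Quot.out_eq]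
    exact e.2
  exact h.ne

theorem mem_iff_out {i : V} {e : Sym2 V} : i ∈ e ↔ i = e.out.1 ∨ i = e.out.2 := by
  conv_lhs => rw [← Quot.out_eq e]
  exact Sym2.mem_iff

variable [DecidableEq V]

variable (G) in
/-- The signed incidence matrix for an arbitrary choice of orientation. -/
noncomputable def signedInc : Matrix V G.edgeSet ℤ := of fun i e =>
  if i = (e : Sym2 V).out.1 then 1 else if i = (e : Sym2 V).out.2 then -1 else 0

theorem signedInc_sq (i : V) (e : G.edgeSet) :
    G.signedInc i e ^ 2 = if i ∈ (e : Sym2 V) then 1 else 0 := by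
  simp only [signedInc, of_apply, mem_iff_out]
  split_ifs <;> simp_all

theorem signedInc_sq_of_mem {i : V} {e : G.edgeSet} (h : i ∈ (e : Sym2 V)) :
    G.signedInc i e ^ 2 = 1 := by
  rw [signedInc_sq, if_pos h]

theorem signedInc_pow_three (i : V) (e : G.edgeSet) :
    G.signedInc i e ^ 3 = G.signedInc i e := by
  simp only [signedInc, of_apply]
  split_ifs <;> simp

theorem signedInc_eq_neg {i j : V} {e : G.edgeSet} (hi : i ∈ (e : Sym2 V))
    (hj : j ∈ (e : Sym2 V)) (hij : i ≠ j) : G.signedInc i e = -G.signedInc j e := by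
  have := out_fst_ne_out_snd e
  rw [mem_iff_out] at hi hj
  simp only [signedInc, of_apply]
  rcases hi with rfl | rfl <;> rcases hj with rfl | rfl <;> simp_all [Ne.symm]

theorem sum_signedInc_mul [Fintype V] {R : Type*} [CommRing R] (e : G.edgeSet) (F : V → R) :
    ∑ i, (G.signedInc i e : R) * F i = F (e : Sym2 V).out.1 - F (e : Sym2 V).out.2 := by
  have h : ∀ i, (G.signedInc i e : R) * F i = (if i = (e : Sym2 V).out.1 then F i else 0) -
      (if i = (e : Sym2 V).out.2 then F i else 0) := by
    intro i
    have := out_fst_ne_out_snd e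
    simp only [signedInc, of_apply]
    split_ifs <;> simp_all
  simp [h, Finset.sum_sub_distrib]

theorem sum_signedInc_sq_left [Fintype V] (e : G.edgeSet) : ∑ i, G.signedInc i e ^ 2 = 2 := by
  have h := sum_signedInc_mul (R := ℤ) e (fun i => G.signedInc i e)
  have hne := (out_fst_ne_out_snd e).symm
  rw [show G.signedInc (e : Sym2 V).out.1 e - G.signedInc (e : Sym2 V).out.2 e = 2 by
    simp [signedInc, hne]] at h
  simpa only [sq, Int.cast_id] using h

variable [Fintype V] [DecidableRel G.Adj]

theorem sum_signedInc_sq_right (i : V) : ∑ e, G.signedInc i e ^ 2 = G.degree i := by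
  simp only [signedInc_sq, Finset.sum_boole]
  rw [← card_incidenceFinset_eq_degree]
  congr 1
  refine Finset.card_bij (fun e _ => (e : Sym2 V)) ?_ ?_ ?_
  · intro e he
    simpa [incidenceSet] using he
  · intro e _ f _ h
    exact Subtype.ext h
  · intro e he
    simp only [mem_incidenceFinset, incidenceSet, Set.mem_sep_iff] at he
    exact ⟨⟨e, he.1⟩, by simpa using he.2, rfl⟩

theorem signedInc_mul_transpose {d : ℕ} (hreg : G.IsRegularOfDegree d) :
    G.signedInc * G.signedIncᵀ = (d : ℤ) • 1 - G.adjMatrix ℤ := by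
  ext i j
  rw [Matrix.mul_apply]
  by_cases hij : i = j
  · subst hij
    have := sum_signedInc_sq_right (G := G) i
    rw [hreg i] at this
    rw [Matrix.sub_apply, Matrix.smul_apply, one_apply_eq, adjMatrix_apply,
      if_neg (G.irrefl), smul_eq_mul, mul_one, sub_zero, ← this]
    exact Finset.sum_congr rfl fun e _ => (sq _).symm
  · by_cases hadj : G.Adj i j
    · rw [Finset.sum_eq_single (⟨s(i, j), hadj⟩ : G.edgeSet)]
      · have hi : i ∈ s(i, j) := Sym2.mem_mk_left i j
        have hj : j ∈ s(i, j) := Sym2.mem_mk_right i j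
        have h1 := signedInc_eq_neg (e := ⟨s(i, j), hadj⟩) hi hj hij
        have h2 := signedInc_sq_of_mem (e := ⟨s(i, j), hadj⟩) hj
        rw [transpose_apply, h1, Matrix.sub_apply, Matrix.smul_apply, one_apply_ne hij,
          adjMatrix_apply, if_pos hadj, smul_zero]
        linear_combination -h2
      · intro e _ he
        by_contra h
        have hi : i ∈ (e : Sym2 V) := by
          by_contra hi
          have := signedInc_sq i e
          simp_all
        have hj : j ∈ (e : Sym2 V) := by
          by_contra hj
          have := signedInc_sq j e
          simp_all
        exact he (Subtype.ext ((Sym2.mem_and_mem_iff hij).1 ⟨hi, hj⟩))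
      · simp
    · rw [Matrix.sub_apply, Matrix.smul_apply, one_apply_ne hij, adjMatrix_apply, if_neg hadj,
        smul_zero, sub_zero]
      refine Finset.sum_eq_zero fun e _ => ?_
      by_contra h
      have hi : i ∈ (e : Sym2 V) := by
        by_contra hi
        have := signedInc_sq i e
        simp_all
      have hj : j ∈ (e : Sym2 V) := by
        by_contra hj
        have := signedInc_sq j e
        simp_all
      have := (Sym2.mem_and_mem_iff hij).1 ⟨hi, hj⟩
      exact hadj (by simpa [this] using e.2)

theorem sum_edgePairs {R : Type*} [CommRing R] (F : V × G.edgeSet × G.edgeSet → R) :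
    ∑ t : G.EdgePairs, F t.1 = ∑ i, ∑ e, ∑ f,
      ((G.signedInc i e ^ 2 * G.signedInc i f ^ 2 : ℤ) : R) * F (i, e, f) := by
  rw [← Finset.sum_subtype (Finset.univ.filter fun t : V × G.edgeSet × G.edgeSet =>
    t.1 ∈ (t.2.1 : Sym2 V) ∧ t.1 ∈ (t.2.2 : Sym2 V)) (by simp)]
  simp only [Finset.sum_filter, Fintype.sum_prod_type, signedInc_sq]
  refine Finset.sum_congr rfl fun i _ => Finset.sum_congr rfl fun e _ =>
    Finset.sum_congr rfl fun f _ => ?_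
  split_ifs <;> simp_all

variable (G) in
/-- The linear forms defining the lattice. -/
noncomputable def constraintForm :
    (G.edgeSet ⊕ G.edgeSet) ⊕ (G.edgeSet ⊕ V) → V × G.edgeSet × G.edgeSet → ℤ
  | .inl (.inl x), t => if x = t.2.1 then if x = t.2.2 then G.signedInc t.1 x else 0 else 0
  | .inl (.inr x), t => if x = t.2.1 then G.signedInc t.1 x else 0
  | .inr (.inl x), t => if x = t.2.2 then G.signedInc t.1 x else 0
  | .inr (.inr i), t => if i = t.1 then 1 else 0

variable (G) in
/-- The integer matrix whose rows are the linear forms defining the lattice. -/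
noncomputable def constraintMatrix :
    Matrix ((G.edgeSet ⊕ G.edgeSet) ⊕ (G.edgeSet ⊕ V)) G.EdgePairs ℤ :=
  of fun k t => G.constraintForm k t.1

theorem constraintMatrix_mul_transpose {d : ℕ} (hreg : G.IsRegularOfDegree d) :
    G.constraintMatrix * G.constraintMatrixᵀ = constraintGram G.signedInc (d : ℤ) := by
  have hV := sum_signedInc_sq_left (G := G)
  have hE : ∀ i, ∑ e, G.signedInc i e ^ 2 = d := fun i => by
    rw [sum_signedInc_sq_right, hreg i]
  have h2 (i e) : G.signedInc i e * G.signedInc i e = G.signedInc i e ^ 2 := (sq _).symm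
  have h3 (i e) : G.signedInc i e ^ 2 * G.signedInc i e = G.signedInc i e := by
    linear_combination signedInc_pow_three i e
  have h4 (i e) : G.signedInc i e ^ 2 * G.signedInc i e ^ 2 = G.signedInc i e ^ 2 := by
    linear_combination G.signedInc i e * signedInc_pow_three i e
  have h1 (i e f) : G.signedInc i e ^ 2 * G.signedInc i f ^ 2 *
      (G.signedInc i e * G.signedInc i f) = G.signedInc i e * G.signedInc i f := by
    linear_combination G.signedInc i f ^ 3 * signedInc_pow_three i e +
      G.signedInc i e * signedInc_pow_three i f
  have h5 (i e f) : G.signedInc i f ^ 2 * G.signedInc i e ^ 2 *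
      (G.signedInc i e * G.signedInc i f) = G.signedInc i e * G.signedInc i f := by
    rw [mul_comm (_ ^ 2), h1]
  have h6 (i e f) : G.signedInc i e ^ 2 * G.signedInc i f ^ 2 * G.signedInc i f =
      G.signedInc i f * G.signedInc i e ^ 2 := by
    linear_combination G.signedInc i e ^ 2 * signedInc_pow_three i f
  have h7 (i e f) : G.signedInc i e ^ 2 * G.signedInc i f ^ 2 * G.signedInc i e =
      G.signedInc i e * G.signedInc i f ^ 2 := by
    linear_combination G.signedInc i f ^ 2 * signedInc_pow_three i e
  have h8 (i e f) : G.signedInc i e ^ 2 * G.signedInc i f ^ 2 * G.signedInc i f ^ 2 =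
      G.signedInc i f ^ 2 * G.signedInc i e ^ 2 := by
    rw [mul_assoc, h4, mul_comm]
  have h9 (i e f) : G.signedInc i e ^ 2 * G.signedInc i f ^ 2 * G.signedInc i e ^ 2 =
      G.signedInc i e ^ 2 * G.signedInc i f ^ 2 := by
    rw [mul_right_comm, h4]
  ext k l
  rw [Matrix.mul_apply]
  refine (sum_edgePairs fun t => G.constraintForm k t * G.constraintForm l t).trans ?_
  rcases k with (x | x) | (x | x) <;> rcases l with (y | y) | (y | y)
  all_goals
    simp only [constraintForm, constraintGram, fromBlocks_apply₁₁, fromBlocks_apply₁₂,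
      fromBlocks_apply₂₁, fromBlocks_apply₂₂, mul_ite, ite_mul, mul_one, mul_zero, zero_mul,
      one_mul, Finset.sum_ite_eq, Finset.mem_univ, if_true, Int.cast_id, Finset.sum_ite_irrel,
      Finset.sum_const_zero, Matrix.smul_apply, smul_eq_mul, Matrix.mul_apply, transpose_apply,
      one_apply]
    try split_ifs with hxy
    try subst hxy
  all_goals
    simp only [h1, h2, h3, h4, h5, h6, h7, h8, h9, ← Finset.mul_sum, ← Finset.sum_mul, hV, hE]
  all_goals ring

end ConstraintMatrix

section Index

variable {V : Type*} {G : SimpleGraph V}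

theorem Connected.exists_eq_of_adj_eq_neg {Q : Type*} [AddCommGroup Q] (hconn : G.Connected)
    (hnb : ¬ G.Colorable 2) {p : V → Q} (hp : ∀ i j, G.Adj i j → p i = -p j) :
    ∃ ρ : Q, ρ + ρ = 0 ∧ ∀ i, p i = ρ := by
  classical
  obtain ⟨i₀⟩ := hconn.nonempty
  have hpm : ∀ i, p i = p i₀ ∨ p i = -p i₀ := by
    intro i
    obtain ⟨w⟩ := hconn.preconnected i i₀
    induction w with
    | nil => exact .inl rfl
    | cons hadj _ ih =>
      rw [hp _ _ hadj]
      rcases ih with h | h <;> simp [h]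
  by_cases h2 : p i₀ = -p i₀
  · refine ⟨p i₀, eq_neg_iff_add_eq_zero.1 h2, fun i => ?_⟩
    rcases hpm i with h | h
    · exact h
    · rw [h, ← h2]
  · refine absurd (Coloring.colorable (Coloring.mk (fun i => decide (p i = p i₀)) ?_)) hnb
    intro i j hadj hij
    rw [decide_eq_decide] at hij
    have h := hp i j hadj
    rcases hpm i with hi | hi
    · rw [hi, hij.1 hi] at h
      exact h2 h
    · rcases hpm j with hj | hj
      · rw [hij.2 hj, hj] at h
        exact h2 h
      · rw [hi, hj, neg_neg] at h
        exact h2 h.symm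

variable [Fintype V] [DecidableEq V] [DecidableRel G.Adj] {d : ℕ}

theorem IsRegularOfDegree.exists_edge (hreg : G.IsRegularOfDegree d) (hd : 3 ≤ d) (i : V) :
    ∃ e : G.edgeSet, i ∈ (e : Sym2 V) := by
  have hpos : 0 < (G.incidenceFinset i).card := by
    rw [card_incidenceFinset_eq_degree, hreg i]
    lia
  obtain ⟨e, he⟩ := Finset.card_pos.1 hpos
  rw [mem_incidenceFinset] at he
  exact ⟨⟨e, he.1⟩, he.2⟩

theorem IsRegularOfDegree.exists_edge_ne_ne (hreg : G.IsRegularOfDegree d) (hd : 3 ≤ d) (i : V)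
    (e e' : G.edgeSet) : ∃ f : G.edgeSet, i ∈ (f : Sym2 V) ∧ f ≠ e ∧ f ≠ e' := by
  have hcard : ({(e : Sym2 V), (e' : Sym2 V)} : Finset (Sym2 V)).card <
      (G.incidenceFinset i).card := by
    rw [card_incidenceFinset_eq_degree, hreg i]
    exact Finset.card_le_two.trans_lt hd
  obtain ⟨f, hf, hne⟩ := Finset.exists_mem_notMem_of_card_lt_card hcard
  rw [mem_incidenceFinset] at hf
  simp only [Finset.mem_insert, Finset.mem_singleton, not_or] at hne
  exact ⟨⟨f, hf.1⟩, hf.2, fun h => hne.1 (congrArg Subtype.val h),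
    fun h => hne.2 (congrArg Subtype.val h)⟩

/-- Signed edge weights that balance at every vertex are constant and of order two. -/
theorem exists_eq_of_signedInc_smul_eq {Q : Type*} [AddCommGroup Q]
    (hreg : G.IsRegularOfDegree d) (hd : 3 ≤ d) (hconn : G.Connected) (hnb : ¬ G.Colorable 2)
    {r : G.edgeSet → Q} (hr : ∀ (i : V) (e e' : G.edgeSet), i ∈ (e : Sym2 V) → i ∈ (e' : Sym2 V) →
      G.signedInc i e • r e = G.signedInc i e' • r e') :
    ∃ ρ : Q, ρ + ρ = 0 ∧ (∀ i (e : G.edgeSet), i ∈ (e : Sym2 V) → G.signedInc i e • r e = ρ) ∧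
      ∀ e, r e = ρ := by
  choose ε hε using hreg.exists_edge hd
  obtain ⟨ρ, hρ, hpρ⟩ := hconn.exists_eq_of_adj_eq_neg hnb
    (p := fun i => G.signedInc i (ε i) • r (ε i)) (by
      intro i j hadj
      have hi : i ∈ ((⟨s(i, j), hadj⟩ : G.edgeSet) : Sym2 V) := Sym2.mem_mk_left i j
      have hj : j ∈ ((⟨s(i, j), hadj⟩ : G.edgeSet) : Sym2 V) := Sym2.mem_mk_right i j
      rw [hr i _ _ (hε i) hi, hr j _ _ (hε j) hj, signedInc_eq_neg hi hj hadj.ne, neg_smul])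
  have hall : ∀ i (e : G.edgeSet), i ∈ (e : Sym2 V) → G.signedInc i e • r e = ρ :=
    fun i e he => (hr i _ _ he (hε i)).trans (hpρ i)
  refine ⟨ρ, hρ, hall, fun e => ?_⟩
  have h := hall (e : Sym2 V).out.1 e (mem_iff_out.2 (.inl rfl))
  simpa [signedInc] using h

theorem exists_eq_of_constraint_relations {Q : Type*} [AddCommGroup Q]
    (hreg : G.IsRegularOfDegree d) (hd : 3 ≤ d) (hconn : G.Connected) (hnb : ¬ G.Colorable 2)
    {a r c : G.edgeSet → Q} {s : V → Q}
    (hrel : ∀ (i : V) (e f : G.edgeSet), i ∈ (e : Sym2 V) → i ∈ (f : Sym2 V) →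
      ((if e = f then G.signedInc i e • a e else 0) + G.signedInc i e • r e) +
        (G.signedInc i f • c f + s i) = 0) :
    ∃ ρ κ : Q, ρ + ρ = 0 ∧ κ + κ = 0 ∧ (∀ e, a e = 0) ∧ (∀ e, r e = ρ) ∧ (∀ e, c e = κ) ∧
      ∀ i, s i = ρ + κ := by
  have hoff : ∀ (i : V) (e f : G.edgeSet), i ∈ (e : Sym2 V) → i ∈ (f : Sym2 V) → e ≠ f →
      G.signedInc i e • r e + (G.signedInc i f • c f + s i) = 0 := by
    intro i e f he hf hne
    simpa [hne] using hrel i e f he hf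
  obtain ⟨ρ, hρ, hρall, hr⟩ := exists_eq_of_signedInc_smul_eq hreg hd hconn hnb (r := r) (by
    intro i e e' he he'
    obtain ⟨f, hf, hfe, hfe'⟩ := hreg.exists_edge_ne_ne hd i e e'
    exact add_right_cancel
      ((hoff i e f he hf hfe.symm).trans (hoff i e' f he' hf hfe'.symm).symm))
  obtain ⟨κ, hκ, hκall, hc⟩ := exists_eq_of_signedInc_smul_eq hreg hd hconn hnb (r := c) (by
    intro i e e' he he'
    obtain ⟨f, hf, hfe, hfe'⟩ := hreg.exists_edge_ne_ne hd i e e'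
    exact add_right_cancel
      (add_left_cancel ((hoff i f e hf he hfe).trans (hoff i f e' hf he' hfe').symm)))
  have hs : ∀ i (e : G.edgeSet), i ∈ (e : Sym2 V) → ρ + (κ + s i) = 0 := by
    intro i e he
    obtain ⟨f, hf, hfe, -⟩ := hreg.exists_edge_ne_ne hd i e e
    have h := hoff i e f he hf hfe.symm
    rwa [hρall i e he, hκall i f hf] at h
  refine ⟨ρ, κ, hρ, hκ, fun e => ?_, hr, hc, fun i => ?_⟩
  · have hmem : (e : Sym2 V).out.1 ∈ (e : Sym2 V) := mem_iff_out.2 (.inl rfl)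
    have h := hrel _ e e hmem hmem
    rw [if_pos rfl, hρall _ e hmem, hκall _ e hmem, add_assoc, hs _ e hmem, add_zero] at h
    simpa [signedInc] using h
  · obtain ⟨e, he⟩ := hreg.exists_edge hd i
    have h := hs i e he
    rw [← add_assoc, add_comm, add_eq_zero_iff_eq_neg] at h
    rw [h, neg_add, ← eq_neg_of_add_eq_zero_left hρ, ← eq_neg_of_add_eq_zero_left hκ]

variable (G) in
/-- The two parities that every value of the constraint matrix satisfies. -/
noncomputable def constraintParity :
    ((G.edgeSet ⊕ G.edgeSet) ⊕ (G.edgeSet ⊕ V) → ℤ) →+ ZMod 2 × ZMod 2 where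
  toFun x := (((∑ e, x (.inl (.inr e)) + ∑ i, x (.inr (.inr i)) : ℤ) : ZMod 2),
    ((∑ e, x (.inr (.inl e)) + ∑ i, x (.inr (.inr i)) : ℤ) : ZMod 2))
  map_zero' := by simp
  map_add' x y := by
    simp only [Pi.add_apply, Finset.sum_add_distrib, Prod.mk_add_mk]
    push_cast
    congr 1 <;> ring

theorem constraintParity_mulVec (v : G.EdgePairs → ℤ) :
    G.constraintParity (G.constraintMatrix *ᵥ v) = 0 := by
  have hodd {i : V} {e : G.edgeSet} (h : i ∈ (e : Sym2 V)) :
      ((G.signedInc i e : ℤ) : ZMod 2) = 1 := by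
    rcases mul_self_eq_one_iff.1 ((sq _).symm.trans (signedInc_sq_of_mem h)) with h | h <;> rw [h] <;> decide
  have h : G.constraintParity.toIntLinearMap ∘ₗ G.constraintMatrix.mulVecLin = 0 := by
    refine (Pi.basisFun ℤ _).ext fun t => ?_
    simp only [Pi.basisFun_apply, LinearMap.comp_apply, mulVecLin_apply, mulVec_single_one,
      AddMonoidHom.coe_toIntLinearMap, LinearMap.zero_apply]
    simp only [constraintParity, constraintMatrix, constraintForm, AddMonoidHom.coe_mk,
      ZeroHom.coe_mk, col_apply, of_apply, Finset.sum_ite_eq', Finset.mem_univ, if_true]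
    push_cast
    rw [hodd t.2.1, hodd t.2.2]
    decide
  exact LinearMap.congr_fun h v

theorem eq_zero_of_constraintParity_eq_zero {Q : Type*} [AddCommGroup Q]
    (hreg : G.IsRegularOfDegree d) (hd : 3 ≤ d) (hconn : G.Connected) (hnb : ¬ G.Colorable 2)
    (π : ((G.edgeSet ⊕ G.edgeSet) ⊕ (G.edgeSet ⊕ V) → ℤ) →ₗ[ℤ] Q)
    (hM : ∀ v, π (G.constraintMatrix *ᵥ v) = 0)
    {x : (G.edgeSet ⊕ G.edgeSet) ⊕ (G.edgeSet ⊕ V) → ℤ} (hx : G.constraintParity x = 0) :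
    π x = 0 := by
  let u := fun k => π fun j => if k = j then 1 else 0
  have hπ (x) : π x = (∑ e, x (.inl (.inl e)) • u (.inl (.inl e)) +
      ∑ e, x (.inl (.inr e)) • u (.inl (.inr e))) +
      (∑ e, x (.inr (.inl e)) • u (.inr (.inl e)) +
      ∑ i, x (.inr (.inr i)) • u (.inr (.inr i))) := by
    simpa only [Fintype.sum_sum_type] using LinearMap.pi_apply_eq_sum_univ π x
  have hrel : ∀ (i : V) (e f : G.edgeSet), i ∈ (e : Sym2 V) → i ∈ (f : Sym2 V) →
      ((if e = f then G.signedInc i e • u (.inl (.inl e)) else 0) +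
        G.signedInc i e • u (.inl (.inr e))) +
      (G.signedInc i f • u (.inr (.inl f)) + u (.inr (.inr i))) = 0 := by
    intro i e f he hf
    have h := hM (Pi.single ⟨(i, e, f), he, hf⟩ 1)
    rw [mulVec_single_one, hπ] at h
    simpa only [constraintMatrix, constraintForm, col_apply, of_apply, ite_smul, zero_smul,
      one_smul, Finset.sum_ite_eq', Finset.mem_univ, if_true] using h
  obtain ⟨ρ, κ, hρ, hκ, ha, hr, hc, hs⟩ :=
    exists_eq_of_constraint_relations hreg hd hconn hnb hrel
  have htwo {n : ℤ} {y : Q}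
      (hn : ((n : ℤ) : ZMod 2) = 0) (hy : y + y = 0) : n • y = 0 := by
    obtain ⟨k, rfl⟩ := (ZMod.intCast_zmod_eq_zero_iff_dvd n 2).1 hn
    rw [mul_comm, mul_smul, Nat.cast_ofNat, two_smul, hy, smul_zero]
  have h1 := htwo (congrArg Prod.fst hx) hρ
  have h2 := htwo (congrArg Prod.snd hx) hκ
  rw [hπ]
  simp only [ha, hr, hc, hs, smul_zero, Finset.sum_const_zero, ← Finset.sum_smul]
  rw [add_smul] at h1 h2
  linear_combination (norm := module) h1 + h2

theorem index_range_constraintMatrix (hreg : G.IsRegularOfDegree d) (hd : 3 ≤ d)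
    (hconn : G.Connected) (hnb : ¬ G.Colorable 2) :
    (LinearMap.range G.constraintMatrix.mulVecLin).toAddSubgroup.index = 4 := by
  have hker : (LinearMap.range G.constraintMatrix.mulVecLin).toAddSubgroup =
      G.constraintParity.ker := by
    refine le_antisymm ?_ fun x hx => ?_
    · rintro _ ⟨v, rfl⟩
      exact constraintParity_mulVec v
    · rw [Submodule.mem_toAddSubgroup, ← Submodule.ker_mkQ (LinearMap.range _), LinearMap.mem_ker]
      exact eq_zero_of_constraintParity_eq_zero hreg hd hconn hnb _
        (fun v => (Submodule.Quotient.mk_eq_zero _).2 (LinearMap.mem_range_self _ v)) hx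
  have hsurj : Function.Surjective G.constraintParity := by
    rintro ⟨p, q⟩
    obtain ⟨i⟩ := hconn.nonempty
    obtain ⟨e, -⟩ := hreg.exists_edge hd i
    refine ⟨Pi.single (.inl (.inr e)) p.val + Pi.single (.inr (.inl e)) q.val, ?_⟩
    simp [constraintParity, Pi.single_apply]
  rw [hker, AddSubgroup.index_ker, AddMonoidHom.range_eq_top.2 hsurj]
  simp

end Index

end SimpleGraph

namespace Matrix

variable {κ ι : Type*} [Fintype ι]

theorem linearIndependent_row_of_det_mul_transpose_ne_zero {m R : Type*} [Fintype m]
    [DecidableEq m] [CommRing R] [IsDomain R] (B : Matrix m ι R) (h : (B * Bᵀ).det ≠ 0) :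
    LinearIndependent R B.row := by
  rw [← vecMul_injective_iff]
  intro x y hxy
  have hxy' : x ᵥ* (B * Bᵀ) = y ᵥ* (B * Bᵀ) := by
    rw [← vecMul_vecMul, ← vecMul_vecMul]
    exact congrArg (· ᵥ* Bᵀ) hxy
  rw [← sub_eq_zero, ← sub_vecMul] at hxy'
  exact sub_eq_zero.1 (eq_zero_of_vecMul_eq_zero h hxy')

theorem exists_real_ker_basis [Fintype κ] [DecidableEq κ] [DecidableEq ι]
    (M : Matrix κ ι ℤ) {q : ℕ} (hq : q ≠ 0)
    (hM : (LinearMap.range M.mulVecLin).toAddSubgroup.index = q) :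
    ∃ (m : ℕ) (b : Fin m → ι → ℝ), LinearIndependent ℝ b ∧
      m + Fintype.card κ = Fintype.card ι ∧
      ∀ x, (∃ n : ι → ℤ, M *ᵥ n = 0 ∧ x = fun t => (n t : ℝ)) ↔
        ∃ c : Fin m → ℤ, x = ∑ i, (c i : ℝ) • b i := by
  obtain ⟨m, b, hb, hker⟩ := exists_ker_basis M
  obtain ⟨hcard, -, hdet⟩ := det_ker_basis_of_index_range M hq hM b hb hker
  refine ⟨m, (b.map (Int.castRingHom ℝ)).row, ?_, hcard, fun x => ?_⟩
  · apply linearIndependent_row_of_det_mul_transpose_ne_zero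
    rw [← transpose_map, ← Matrix.map_mul, ← RingHom.mapMatrix_apply, ← RingHom.map_det]
    simpa using hdet
  · have hcast (c : Fin m → ℤ) : (fun t => ((c ᵥ* b) t : ℝ)) =
        ∑ i, (c i : ℝ) • (b.map (Int.castRingHom ℝ)).row i := by
      ext t
      simp [vecMul, dotProduct]
    constructor
    · rintro ⟨n, hn, rfl⟩
      obtain ⟨c, rfl⟩ := (hker n).1 hn
      exact ⟨c, hcast c⟩
    · rintro ⟨c, rfl⟩
      exact ⟨c ᵥ* b, (hker _).2 ⟨c, rfl⟩, (hcast c).symm⟩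

theorem det_gram_real_ker_basis [Fintype κ] [DecidableEq κ] [DecidableEq ι]
    (M : Matrix κ ι ℤ) {q : ℕ} (hq : q ≠ 0)
    (hM : (LinearMap.range M.mulVecLin).toAddSubgroup.index = q)
    {m : ℕ} {b : Fin m → ι → ℝ} (hb : LinearIndependent ℝ b)
    (hspan : ∀ x, (∃ n : ι → ℤ, M *ᵥ n = 0 ∧ x = fun t => (n t : ℝ)) ↔
      ∃ c : Fin m → ℤ, x = ∑ i, (c i : ℝ) • b i) :
    m + Fintype.card κ = Fintype.card ι ∧
      (of fun i j => ∑ t, b i t * b j t).det * (q : ℝ) ^ 2 = ((M * Mᵀ).det : ℝ) := by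
  have hint (i) : ∃ n : ι → ℤ, M *ᵥ n = 0 ∧ b i = fun t => (n t : ℝ) :=
    (hspan _).2 ⟨Pi.single i 1, by simp [Pi.single_apply]⟩
  choose B hMB hB using hint
  have hcast (c : Fin m → ℤ) : ∑ i, (c i : ℝ) • b i = fun t => ((c ᵥ* of B) t : ℝ) := by
    ext t
    simp [hB, vecMul, dotProduct]
  have hinj : Function.Injective fun (x : ι → ℤ) t => (x t : ℝ) := fun x y h =>
    funext fun t => Int.cast_injective (congrFun h t)
  have hli : LinearIndependent ℤ (of B).row := by
    rw [← vecMul_injective_iff]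
    intro x y hxy
    have h := congrArg (fun (v : ι → ℤ) t => (v t : ℝ)) hxy
    simp only [← hcast] at h
    rw [← sub_eq_zero, ← Finset.sum_sub_distrib] at h
    simp only [← sub_smul] at h
    ext i
    have hi := Fintype.linearIndependent_iff.1 hb _ h i
    exact_mod_cast sub_eq_zero.1 hi
  have hker (x) : M *ᵥ x = 0 ↔ ∃ a : Fin m → ℤ, x = a ᵥ* of B := by
    constructor
    · intro hx
      obtain ⟨c, hc⟩ := (hspan _).1 ⟨x, hx, rfl⟩
      exact ⟨c, hinj (hc.trans (hcast c))⟩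
    · rintro ⟨c, rfl⟩
      obtain ⟨n, hn, hc⟩ := (hspan _).2 ⟨c, rfl⟩
      rw [hcast] at hc
      rwa [hinj hc]
  obtain ⟨hcard, hdet, -⟩ := det_ker_basis_of_index_range M hq hM (of B) hli hker
  refine ⟨hcard, ?_⟩
  rw [← hdet, Int.cast_mul, Int.cast_pow, Int.cast_natCast, Int.cast_det]
  congr 2
  ext i j
  simp [hB, Matrix.mul_apply]

theorem map_intCast_mulVec_eq_zero_iff (M : Matrix κ ι ℤ) (n : ι → ℤ) :
    (M.map (Int.cast : ℤ → ℝ)).mulVec (fun t => (n t : ℝ)) = 0 ↔ M.mulVec n = 0 := by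
  have h (k : κ) : (M.map (Int.cast : ℤ → ℝ)).mulVec (fun t => (n t : ℝ)) k =
      (M.mulVec n k : ℤ) := by
    simp [mulVec, dotProduct]
  simp only [funext_iff, h, Pi.zero_apply, Int.cast_eq_zero]

end Matrix

namespace SimpleGraph

open Matrix Polynomial

variable {V : Type*} [Fintype V] {G : SimpleGraph V} [DecidableRel G.Adj] {d : ℕ}

theorem IsRegularOfDegree.two_mul_card_edgeSet (hreg : G.IsRegularOfDegree d) :
    2 * Fintype.card G.edgeSet = d * Fintype.card V := by
  rw [← edgeFinset_card, ← sum_degrees_eq_twice_card_edges, Finset.sum_congr rfl fun i _ => hreg i,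
    Finset.sum_const, Finset.card_univ, smul_eq_mul, mul_comm]

variable [DecidableEq V]

theorem card_edgePairs (hreg : G.IsRegularOfDegree d) :
    Fintype.card G.EdgePairs = d ^ 2 * Fintype.card V := by
  have h := sum_edgePairs (G := G) (R := ℤ) fun _ => 1
  have hE (i) : ∑ e, G.signedInc i e ^ 2 = d := by rw [sum_signedInc_sq_right, hreg i]
  simp only [Int.cast_id, mul_one, ← Finset.mul_sum, hE, ← Finset.sum_mul, Finset.sum_const,
    Finset.card_univ, nsmul_eq_mul] at h
  zify
  rw [h]
  ring

theorem det_constraintMatrix_mul_transpose (hreg : G.IsRegularOfDegree d) (hd : 3 ≤ d)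
    {ι : Type*} [Fintype ι] {α : ι → ℝ} (hα : (G.adjMatrix ℝ).charpoly = ∏ i, (X - C (α i))) :
    ((G.constraintMatrix * G.constraintMatrixᵀ).det : ℝ) =
      2 ^ Fintype.card G.edgeSet *
        ((2 * d) * (2 * d - 4)) ^ (Fintype.card G.edgeSet - Fintype.card V) *
        ((1 / 2) ^ Fintype.card V *
          ((∏ i, (d + α i)) ^ 2 * ∏ i, (d * (2 * d - 3) - α i))) := by
  have hle : Fintype.card V ≤ Fintype.card G.edgeSet := by
    have := hreg.two_mul_card_edgeSet
    nlinarith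
  have hd' : (2 : ℝ) < d := by exact_mod_cast hd
  have hN : G.signedInc.map (Int.castRingHom ℝ) * (G.signedInc.map (Int.castRingHom ℝ))ᵀ =
      (d : ℝ) • 1 - G.adjMatrix ℝ := by
    rw [← transpose_map, ← Matrix.map_mul, signedInc_mul_transpose hreg]
    ext i j
    simp only [map_apply, Matrix.sub_apply, Matrix.smul_apply, one_apply, adjMatrix_apply]
    split_ifs <;> simp
  have hmap : (constraintGram G.signedInc (d : ℤ)).map (Int.castRingHom ℝ) =
      constraintGram (G.signedInc.map (Int.castRingHom ℝ)) (d : ℝ) := by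
    ext k l
    rcases k with (x | x) | (x | x) <;> rcases l with (y | y) | (y | y) <;>
      simp only [constraintGram, map_apply, fromBlocks_apply₁₁, fromBlocks_apply₁₂,
        fromBlocks_apply₂₁, fromBlocks_apply₂₂, Matrix.smul_apply, one_apply, transpose_apply,
        Matrix.mul_apply]
    all_goals
      try split_ifs
    all_goals simp
  rw [constraintMatrix_mul_transpose hreg, Int.cast_det]
  refine (congrArg det hmap).trans ?_
  rw [det_constraintGram _ hd' hle, hN,
    show ((2 * d : ℝ) • 1 - ((d : ℝ) • 1 - G.adjMatrix ℝ)) = (d : ℝ) • 1 + G.adjMatrix ℝ by module,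
    show ((2 * d * (d - 2) : ℝ) • 1 + ((d : ℝ) • 1 - G.adjMatrix ℝ)) =
      (d * (2 * d - 3) : ℝ) • 1 - G.adjMatrix ℝ by module,
    det_smul_one_add_eq_prod hα, det_smul_one_sub_eq_prod hα]

theorem constraintMatrix_mulVec_eq_zero_iff (z : G.EdgePairs → ℝ) :
    G.constraintMatrix.map (Int.cast : ℤ → ℝ) *ᵥ z = 0 ↔
      (∀ (e : G.edgeSet) (i j : V) (hi : i ∈ (e : Sym2 V)) (hj : j ∈ (e : Sym2 V)),
        i ≠ j →
        z ⟨(i, e, e), hi, hi⟩ = z ⟨(j, e, e), hj, hj⟩ ∧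
        (∑ f : G.edgeSet, if hf : i ∈ (f : Sym2 V) then z ⟨(i, e, f), hi, hf⟩ else 0) =
          (∑ f : G.edgeSet, if hf : j ∈ (f : Sym2 V) then z ⟨(j, e, f), hj, hf⟩ else 0) ∧
        (∑ f : G.edgeSet, if hf : i ∈ (f : Sym2 V) then z ⟨(i, f, e), hf, hi⟩ else 0) =
          (∑ f : G.edgeSet, if hf : j ∈ (f : Sym2 V) then z ⟨(j, f, e), hf, hj⟩ else 0)) ∧
      ∀ i : V, (∑ t : G.EdgePairs, if t.1.1 = i then z t else 0) = 0 := by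
  let w : V → G.edgeSet → G.edgeSet → ℝ := fun i e f =>
    if h : i ∈ (e : Sym2 V) ∧ i ∈ (f : Sym2 V) then z ⟨(i, e, f), h⟩ else 0
  have hw (i : V) (e f : G.edgeSet) :
      ((G.signedInc i e ^ 2 * G.signedInc i f ^ 2 : ℤ) : ℝ) * w i e f = w i e f := by
    simp only [signedInc_sq, w]
    split_ifs <;> simp_all
  have hsum (k) : (G.constraintMatrix.map (Int.cast : ℤ → ℝ) *ᵥ z) k =
      ∑ i, ∑ e, ∑ f, (G.constraintForm k (i, e, f) : ℝ) * w i e f := by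
    have h := sum_edgePairs fun t => (G.constraintForm k t : ℝ) * w t.1 t.2.1 t.2.2
    simp only [mul_left_comm _ (G.constraintForm k _ : ℝ), hw] at h
    rw [← h]
    refine Finset.sum_congr rfl fun t _ => ?_
    simp only [w, dif_pos t.2]
    rfl
  have hrow {i : V} {e : G.edgeSet} (hi : i ∈ (e : Sym2 V)) :
      (∑ f : G.edgeSet, if hf : i ∈ (f : Sym2 V) then z ⟨(i, e, f), hi, hf⟩ else 0) =
        ∑ f, w i e f := by
    simp [w, hi]
  have hcol {i : V} {e : G.edgeSet} (hi : i ∈ (e : Sym2 V)) :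
      (∑ f : G.edgeSet, if hf : i ∈ (f : Sym2 V) then z ⟨(i, f, e), hf, hi⟩ else 0) =
        ∑ f, w i f e := by
    simp [w, hi]
  have hdiag {i : V} {e : G.edgeSet} (hi : i ∈ (e : Sym2 V)) :
      z ⟨(i, e, e), hi, hi⟩ = w i e e := by
    simp [w, hi]
  have hsigned (e : G.edgeSet) (F : V → ℝ) : ∑ i, (G.signedInc i e : ℝ) * F i = 0 ↔
      ∀ i j, i ∈ (e : Sym2 V) → j ∈ (e : Sym2 V) → i ≠ j → F i = F j := by
    rw [sum_signedInc_mul, sub_eq_zero]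
    constructor
    · intro h i j hi hj _
      rw [mem_iff_out] at hi hj
      rcases hi with rfl | rfl <;> rcases hj with rfl | rfl <;> simp [h]
    · intro h
      exact h _ _ (mem_iff_out.2 (.inl rfl)) (mem_iff_out.2 (.inr rfl)) (out_fst_ne_out_snd e)
  have hvertex (i : V) : (∑ t : G.EdgePairs, if t.1.1 = i then z t else 0) =
      (G.constraintMatrix.map (Int.cast : ℤ → ℝ) *ᵥ z) (.inr (.inr i)) := by
    refine Finset.sum_congr rfl fun t _ => ?_
    simp [constraintMatrix, constraintForm, eq_comm]
  have ha (e) : (G.constraintMatrix.map (Int.cast : ℤ → ℝ) *ᵥ z) (.inl (.inl e)) =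
      ∑ i, (G.signedInc i e : ℝ) * w i e e := by
    simp [hsum, constraintForm, apply_ite]
  have hr (e) : (G.constraintMatrix.map (Int.cast : ℤ → ℝ) *ᵥ z) (.inl (.inr e)) =
      ∑ i, (G.signedInc i e : ℝ) * ∑ f, w i e f := by
    simp [hsum, constraintForm, Finset.mul_sum]
  have hc (e) : (G.constraintMatrix.map (Int.cast : ℤ → ℝ) *ᵥ z) (.inr (.inl e)) =
      ∑ i, (G.signedInc i e : ℝ) * ∑ f, w i f e := by
    simp [hsum, constraintForm, Finset.mul_sum]
  rw [funext_iff, Sum.forall, Sum.forall, Sum.forall]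
  simp only [Pi.zero_apply, ha, hr, hc, ← hvertex, hsigned]
  constructor
  · rintro ⟨⟨h1, h2⟩, h3, h4⟩
    refine ⟨fun e i j hi hj hij => ?_, h4⟩
    rw [hdiag hi, hdiag hj, hrow hi, hrow hj, hcol hi, hcol hj]
    exact ⟨h1 e i j hi hj hij, h2 e i j hi hj hij, h3 e i j hi hj hij⟩
  · rintro ⟨h, h4⟩
    have h' (e : G.edgeSet) (i j) (hi : i ∈ (e : Sym2 V)) (hj : j ∈ (e : Sym2 V)) (hij : i ≠ j) := by
      have := h e i j hi hj hij
      rwa [hdiag hi, hdiag hj, hrow hi, hrow hj, hcol hi, hcol hj] at this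
    exact ⟨⟨fun e i j hi hj hij => (h' e i j hi hj hij).1,
      fun e i j hi hj hij => (h' e i j hi hj hij).2.1⟩,
      fun e i j hi hj hij => (h' e i j hi hj hij).2.2, h4⟩

end SimpleGraph

theorem sqrt_eq_of_mul_sq_four {d D P Q : ℝ} {g h : ℕ} (hd : 2 < d) (hgh : g ≤ h) (hP : 0 ≤ P)
    (hQ : 0 ≤ Q)
    (hD : D * 4 ^ 2 = 2 ^ h * ((2 * d) * (2 * d - 4)) ^ (h - g) * ((1 / 2) ^ g * (P ^ 2 * Q))) :
    √D = (2 : ℝ) ^ ((3 * h : ℝ) / 2 - (3 * g : ℝ) / 2 - 2) *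
      (d * (d - 2)) ^ ((h : ℝ) / 2 - (g : ℝ) / 2) * (P * √Q) := by
  obtain ⟨k, rfl⟩ := Nat.exists_eq_add_of_le hgh
  have hX : 0 < d * (d - 2) := mul_pos (by linarith) (by linarith)
  have h2 : ((2 : ℝ) ^ ((3 * (g + k : ℕ) : ℝ) / 2 - (3 * g : ℝ) / 2 - 2)) ^ 2 * 4 ^ 2 = 8 ^ k := by
    rw [← Real.rpow_natCast, ← Real.rpow_mul (by norm_num),
      show (4 : ℝ) ^ 2 = (2 : ℝ) ^ (4 : ℝ) by norm_num,
      ← Real.rpow_add (by norm_num), show (8 : ℝ) = 2 ^ (3 : ℝ) by norm_num, ← Real.rpow_natCast,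
      ← Real.rpow_mul (by norm_num)]
    congr 1
    push_cast
    ring
  have hXk : ((d * (d - 2)) ^ (((g + k : ℕ) : ℝ) / 2 - (g : ℝ) / 2)) ^ 2 = (d * (d - 2)) ^ k := by
    rw [← Real.rpow_natCast, ← Real.rpow_mul hX.le, ← Real.rpow_natCast (d * (d - 2)) k]
    congr 1
    push_cast
    ring
  have hsq : D = ((2 : ℝ) ^ ((3 * (g + k : ℕ) : ℝ) / 2 - (3 * g : ℝ) / 2 - 2) *
      (d * (d - 2)) ^ (((g + k : ℕ) : ℝ) / 2 - (g : ℝ) / 2) * (P * √Q)) ^ 2 := by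
    refine mul_right_cancel₀ (b := (4 : ℝ) ^ 2) (by norm_num) ?_
    trans 8 ^ k * (d * (d - 2)) ^ k * (P ^ 2 * Q)
    · rw [hD, Nat.add_sub_cancel_left, show 2 * d * (2 * d - 4) = 4 * (d * (d - 2)) by ring,
        mul_pow, show (8 : ℝ) = 2 * 4 by norm_num, mul_pow 2 4, pow_add, one_div, inv_pow]
      field_simp
    · rw [← h2, ← hXk, mul_pow, mul_pow, mul_pow, Real.sq_sqrt hQ]
      ring
  rw [hsq, Real.sqrt_sq (by positivity)]

open Polynomial in
open Classical in
/-- Let `G` be a finite connected non-bipartite `d`-regular simple graph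
(`d ≥ 3`) with `g` vertices and `h = dg/2` edges, whose adjacency matrix has eigenvalues
`α₁,…,α_g`.  With `I = {(i,e,f) : i ∈ V(G), e,f ∋ i}` and `V*` the subspace of
`ℝ^I` cut out by the conditions `z_{iee} = z_{jee}`, `∑_{f∋i} z_{ief} = ∑_{f∋j} z_{jef}`,
`∑_{f∋i} z_{ife} = ∑_{f∋j} z_{jfe}` for every edge `e = ij`, the lattice
`L² = {ν ∈ V* ∩ ℤ^I : ∑_{e,f∋i} ν_{ief} = 0 ∀i}` has rank `d²g − g − 3dg/2 = d²g − g − 3h`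
and determinant `Vol(L²) = 2^{3h/2−3g/2−2}(d(d−2))^{h/2−g/2}∏ᵢ(d+αᵢ)(d(2d−3)−αᵢ)^{1/2}`:
every ℤ-basis of `L²` has that many elements and that Gram-determinant square root,
and such a ℤ-basis exists. -/
theorem stmt_12 {V : Type*} [Fintype V] [DecidableEq V] (G : SimpleGraph V)
    [DecidableRel G.Adj] (d g h : ℕ) (hd : 3 ≤ d)
    (hreg : G.IsRegularOfDegree d)
    (hconn : G.Connected) (hnb : ¬ G.Colorable 2)
    (hg : Fintype.card V = g) (hh : Fintype.card G.edgeSet = h) (hdg : 2 * h = d * g)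
    (α : Fin g → ℝ)
    (hα : (G.adjMatrix ℝ).charpoly = ∏ i, (X - C (α i)))
    (Vstar : Set ({t : V × G.edgeSet × G.edgeSet //
        t.1 ∈ (t.2.1 : Sym2 V) ∧ t.1 ∈ (t.2.2 : Sym2 V)} → ℝ))
    (hVstar : Vstar = {z |
      ∀ (e : G.edgeSet) (i j : V) (hi : i ∈ (e : Sym2 V)) (hj : j ∈ (e : Sym2 V)),
        i ≠ j →
        z ⟨(i, e, e), hi, hi⟩ = z ⟨(j, e, e), hj, hj⟩ ∧
        (∑ f : G.edgeSet, if hf : i ∈ (f : Sym2 V) then z ⟨(i, e, f), hi, hf⟩ else 0) =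
          (∑ f : G.edgeSet, if hf : j ∈ (f : Sym2 V) then z ⟨(j, e, f), hj, hf⟩ else 0) ∧
        (∑ f : G.edgeSet, if hf : i ∈ (f : Sym2 V) then z ⟨(i, f, e), hf, hi⟩ else 0) =
          (∑ f : G.edgeSet, if hf : j ∈ (f : Sym2 V) then z ⟨(j, f, e), hf, hj⟩ else 0)})
    (L : Set ({t : V × G.edgeSet × G.edgeSet //
        t.1 ∈ (t.2.1 : Sym2 V) ∧ t.1 ∈ (t.2.2 : Sym2 V)} → ℝ))
    (hL : L = {ν | ν ∈ Vstar ∧ (∀ t, ∃ k : ℤ, ν t = (k : ℝ)) ∧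
        ∀ i : V, (∑ t : {t : V × G.edgeSet × G.edgeSet //
            t.1 ∈ (t.2.1 : Sym2 V) ∧ t.1 ∈ (t.2.2 : Sym2 V)},
          if t.1.1 = i then ν t else 0) = 0}) :
    (∃ b : Fin (d ^ 2 * g - g - 3 * h) →
        ({t : V × G.edgeSet × G.edgeSet //
          t.1 ∈ (t.2.1 : Sym2 V) ∧ t.1 ∈ (t.2.2 : Sym2 V)} → ℝ),
      LinearIndependent ℝ b ∧
        ∀ x, x ∈ L ↔ ∃ c : Fin (d ^ 2 * g - g - 3 * h) → ℤ,
          x = ∑ i, (c i : ℝ) • b i) ∧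
    (∀ (m : ℕ) (b : Fin m → ({t : V × G.edgeSet × G.edgeSet //
          t.1 ∈ (t.2.1 : Sym2 V) ∧ t.1 ∈ (t.2.2 : Sym2 V)} → ℝ)),
        LinearIndependent ℝ b →
        (∀ x, x ∈ L ↔ ∃ c : Fin m → ℤ, x = ∑ i, (c i : ℝ) • b i) →
        m = d ^ 2 * g - g - 3 * h ∧
        Real.sqrt (Matrix.det (Matrix.of fun i j => ∑ t, b i t * b j t)) =
          (2:ℝ) ^ ((3 * h : ℝ) / 2 - (3 * g : ℝ) / 2 - 2) *
            ((d:ℝ) * ((d:ℝ) - 2)) ^ ((h:ℝ) / 2 - (g:ℝ) / 2) *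
            ∏ i : Fin g, (((d:ℝ) + α i) *
              Real.sqrt ((d:ℝ) * (2 * (d:ℝ) - 3) - α i))) := by
  have hE : Fintype.card G.edgeSet = h := by convert! hh
  have hcardV : Fintype.card V ≤ Fintype.card G.edgeSet := by
    have := hreg.two_mul_card_edgeSet
    nlinarith
  have hrange := SimpleGraph.index_range_constraintMatrix hreg hd hconn hnb
  have hmem : ∀ x, (∃ n : G.EdgePairs → ℤ, G.constraintMatrix.mulVec n = 0 ∧
      x = fun t => (n t : ℝ)) ↔ x ∈ L := by
    intro x
    rw [hL, hVstar]
    have h := SimpleGraph.constraintMatrix_mulVec_eq_zero_iff (G := G) x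
    constructor
    · rintro ⟨n, hn, rfl⟩
      rw [← Matrix.map_intCast_mulVec_eq_zero_iff] at hn
      refine ⟨?_, fun t => ⟨n t, rfl⟩, ?_⟩
      · convert! (h.1 hn).1
      · convert! (h.1 hn).2
    · rintro ⟨hx, hint, hv⟩
      choose n hn using hint
      obtain rfl : x = fun t => (n t : ℝ) := funext hn
      refine ⟨n, (Matrix.map_intCast_mulVec_eq_zero_iff _ n).1 (h.2 ⟨?_, ?_⟩), rfl⟩
      · convert! hx
      · convert! hv
  have hcard {m : ℕ} (hm : m + Fintype.card ((G.edgeSet ⊕ G.edgeSet) ⊕ (G.edgeSet ⊕ V)) =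
      Fintype.card G.EdgePairs) : m = d ^ 2 * g - g - 3 * h := by
    have hI := SimpleGraph.card_edgePairs hreg
    simp only [Fintype.card_sum] at hm
    rw [hI, hE, hg] at hm
    lia
  refine ⟨?_, fun m b hb hspan => ?_⟩
  · obtain ⟨m, b, hb, hm, hspan⟩ :=
      G.constraintMatrix.exists_real_ker_basis (by norm_num) hrange
    obtain rfl := hcard hm
    exact ⟨b, hb, fun x => (hmem x).symm.trans (hspan x)⟩
  · obtain ⟨hm, hdet⟩ := G.constraintMatrix.det_gram_real_ker_basis (by norm_num) hrange hb
      fun x => (hmem x).trans (hspan x)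
    refine ⟨hcard hm, ?_⟩
    have hd' : (3 : ℝ) ≤ d := by exact_mod_cast hd
    have hnonneg (i) : 0 ≤ d + α i := by
      linarith [hreg.posSemidef_add_adjMatrix.neg_le_charpoly_root hα i]
    have hnonneg' (i) : 0 ≤ d * (2 * d - 3) - α i := by
      nlinarith [hreg.posSemidef_sub_adjMatrix.charpoly_root_le hα i]
    rw [SimpleGraph.det_constraintMatrix_mul_transpose hreg hd hα] at hdet
    rw [Finset.prod_mul_distrib, ← Real.sqrt_prod _ fun i _ => hnonneg' i]
    refine sqrt_eq_of_mul_sq_four (by linarith) ?_ (Finset.prod_nonneg fun i _ => hnonneg i)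
      (Finset.prod_nonneg fun i _ => hnonneg' i) ?_
    · rw [← hg, ← hE]
      convert! hcardV
    · rw [hE, hg] at hdet
      convert! hdet
end

section
/- Let G be a finite d-regular simple graph with g vertices and adjacency matrix A having eigenvalues α₁,…,α_g, where d ≥ 3, and let R be the matrix indexed by the darts of G with R_{(u,v),(p,q)} = 1 if p = v and (p,q) ≠ (v,u), and 0 otherwise. For each i let β_i^+ and β_i^− denote the two roots of x² − α_i x + (d−1) = 0, i.e. β_i^± = α_i/2 ± (α_i²/4 − (d−1))^{1/2}. Then for every integer k ≥ 2, the number w_k of closed non-backtracking k-walks in G satisfies w_k = Tr(R^k) = (1/2)·g(d−2)·(1 + (−1)^k) + Σ_{i=1}^g ((β_i^+)^k + (β_i^−)^k). -/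
open Polynomial Matrix in
/-- The trace of a polynomial in a Hermitian matrix is the sum of its values at the eigenvalues. -/
theorem Matrix.IsHermitian.trace_aeval {n 𝕜 : Type*} [Fintype n] [DecidableEq n] [RCLike 𝕜]
    {A : Matrix n n 𝕜} (hA : A.IsHermitian) (p : 𝕜[X]) :
    trace (aeval A p) = (A.charpoly.roots.map fun x => p.eval x).sum := by
  have hdiag (v : n → 𝕜) : aeval (diagonal v) p = diagonal fun i => p.eval (v i) := by
    induction p using Polynomial.induction_on' with
    | add p q hp hq => simp [hp, hq, diagonal_add]
    | monomial m a =>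
      simp [aeval_monomial, diagonal_pow, algebraMap_eq_diagonal, diagonal_mul_diagonal]
  rw [hA.roots_charpoly_eq_eigenvalues]
  conv_lhs => rw [hA.spectral_theorem, aeval_algHom_apply, hdiag]
  rw [Unitary.conjStarAlgAut_apply, trace_mul_cycle]
  simp [trace_diagonal]

open Polynomial in
theorem Polynomial.dickson_one_zero {R : Type*} [CommRing R] (a : R) :
    dickson 1 a 0 = C 2 := by
  simp only [dickson_zero, map_ofNat, Nat.cast_one]
  norm_num

open Polynomial in
/-- The Dickson polynomial of the first kind at `x + y` with parameter `x * y`. -/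
theorem Polynomial.eval_dickson_one_add {R : Type*} [CommRing R] (x y : R) :
    ∀ n : ℕ, (dickson 1 (x * y) n).eval (x + y) = x ^ n + y ^ n
  | 0 => by simp; norm_num
  | 1 => by simp
  | n + 2 => by
    simp only [dickson_add_two, eval_sub, eval_mul, eval_X, eval_C, eval_dickson_one_add x y n,
      eval_dickson_one_add x y (n + 1)]
    ring

/-- The trace of a product with a power of a matrix, as a sum over tuples of indices. -/
theorem Matrix.trace_pow_mul {ι R : Type*} [Fintype ι] [DecidableEq ι] [CommSemiring R]
    (M : Matrix ι ι R) (n : ℕ) (N : Matrix ι ι R) :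
    trace (M ^ n * N) = ∑ f : Fin (n + 1) → ι,
      (∏ i : Fin n, M (f i.castSucc) (f i.succ)) * N (f (Fin.last n)) (f 0) := by
  induction n generalizing N with
  | zero =>
    rw [← (Equiv.funUnique (Fin 1) ι).symm.sum_comp]
    simp [trace]
  | succ n ih =>
    rw [pow_succ, Matrix.mul_assoc, ih, ← (Fin.snocEquiv fun _ : Fin (n + 2) => ι).sum_comp,
      Fintype.sum_prod_type_right]
    refine Finset.sum_congr rfl fun f _ => ?_
    have hs (x : ι) (i : Fin n) :
        Fin.snoc (α := fun _ => ι) f x i.castSucc.succ = f i.succ := by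
      rw [Fin.succ_castSucc, Fin.snoc_castSucc]
    have h0 (x : ι) : Fin.snoc (α := fun _ => ι) f x (0 : Fin (n + 2)) = f 0 :=
      Fin.snoc_castSucc (α := fun _ => ι) (i := 0) ..
    simp only [mul_apply, Finset.mul_sum, Fin.prod_univ_castSucc, Fin.snocEquiv_apply, h0, hs,
      Fin.snoc_castSucc, Fin.snoc_last, Fin.succ_last, mul_assoc]

/-- The trace of a positive power of a matrix, as a sum over cyclic tuples of indices. -/
theorem Matrix.trace_pow_succ {ι R : Type*} [Fintype ι] [DecidableEq ι] [CommSemiring R]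
    (M : Matrix ι ι R) (n : ℕ) :
    trace (M ^ (n + 1)) = ∑ f : Fin (n + 1) → ι, ∏ i, M (f i) (f (i + 1)) := by
  simp [pow_succ, trace_pow_mul, Fin.prod_univ_castSucc]

namespace SimpleGraph

variable {V : Type*} {G : SimpleGraph V}

theorem Dart.eq_symm_iff {a b : G.Dart} : b = a.symm ↔ b.fst = a.snd ∧ b.snd = a.fst := by
  rw [Dart.ext_iff, Prod.ext_iff]; rfl

/-- Closed non-backtracking vertex walks correspond to cyclic sequences of darts. -/
def closedNonbacktrackingEquiv (G : SimpleGraph V) (n : ℕ) :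
    {v : ZMod (n + 1) → V // ∀ j, G.Adj (v j) (v (j + 1)) ∧ v (j + 2) ≠ v j} ≃
      {f : Fin (n + 1) → G.Dart //
        ∀ i, (f (i + 1)).fst = (f i).snd ∧ f (i + 1) ≠ (f i).symm} where
  toFun v := ⟨fun i : ZMod (n + 1) => ⟨(v.1 i, v.1 (i + 1)), (v.2 i).1⟩,
    fun i : ZMod (n + 1) => ⟨rfl, fun h => (v.2 i).2 <| by
      have h2 : v.1 (i + 1 + 1) = v.1 i := (Dart.eq_symm_iff.1 h).2
      rwa [add_assoc, one_add_one_eq_two] at h2⟩⟩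
  invFun f := ⟨fun i => (f.1 i).fst, fun i => by
    beta_reduce
    have h1 : (f.1 (i + 1 : ZMod (n + 1))).fst = (f.1 i).snd := (f.2 i).1
    have h2 : (f.1 (i + 1 + 1 : ZMod (n + 1))).fst = (f.1 (i + 1 : ZMod (n + 1))).snd :=
      (f.2 (i + 1 : ZMod (n + 1))).1
    refine ⟨h1.symm ▸ (f.1 i).adj, fun h => (f.2 i).2 (Dart.eq_symm_iff.2 ⟨h1, h2.symm.trans ?_⟩)⟩
    rw [add_assoc, one_add_one_eq_two]
    exact h⟩
  left_inv v := rfl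
  right_inv f := Subtype.ext <| funext fun i => Dart.ext _ _ <| Prod.ext rfl (f.2 i).1

variable [DecidableEq V]

variable (G) in
/-- The non-backtracking (Hashimoto) matrix of a graph, indexed by darts. -/
def nonbacktrackingMatrix (K : Type*) [Zero K] [One K] : Matrix G.Dart G.Dart K :=
  Matrix.of fun a b => if b.fst = a.snd ∧ b ≠ a.symm then 1 else 0

variable {K : Type*} [CommRing K]

open Matrix

variable (G K) in
/-- The incidence matrix of darts and their tails. -/
def dartFstMatrix : Matrix G.Dart V K := Matrix.of fun a v => if a.fst = v then 1 else 0

variable (G K) in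
/-- The incidence matrix of darts and their heads. -/
def dartSndMatrix : Matrix G.Dart V K := Matrix.of fun a v => if a.snd = v then 1 else 0

variable (G K) in
/-- The permutation matrix of dart reversal. -/
def dartSymmMatrix : Matrix G.Dart G.Dart K := Matrix.of fun a b => if b = a.symm then 1 else 0

local notation "S" => dartFstMatrix G K
local notation "T" => dartSndMatrix G K
local notation "J" => dartSymmMatrix G K
local notation "B" => nonbacktrackingMatrix G K

theorem transpose_dartSymmMatrix : Jᵀ = J := by
  ext a b
  have : a = b.symm ↔ b = a.symm := by
    constructor <;> rintro rfl <;> simp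
  simp [dartSymmMatrix, this]

variable [Fintype V]

theorem nonbacktrackingMatrix_eq : B = T * Sᵀ - J := by
  ext a b
  have h : b = a.symm → a.snd = b.fst := fun h => (Dart.eq_symm_iff.1 h).1.symm
  simp only [nonbacktrackingMatrix, dartFstMatrix, dartSndMatrix, dartSymmMatrix, Matrix.sub_apply,
    Matrix.mul_apply, Matrix.of_apply, Matrix.transpose_apply]
  simp only [mul_ite, mul_one, mul_zero, Finset.sum_ite_eq, Finset.mem_univ, if_true]
  by_cases h1 : b = a.symm
  · simp [h1]
  · simp [h1, eq_comm]

variable [DecidableRel G.Adj]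

theorem trace_nonbacktrackingMatrix_pow_succ (n : ℕ) :
    trace (G.nonbacktrackingMatrix K ^ (n + 1)) =
      Nat.card {v : ZMod (n + 1) → V // ∀ j, G.Adj (v j) (v (j + 1)) ∧ v (j + 2) ≠ v j} := by
  rw [Nat.card_congr (G.closedNonbacktrackingEquiv n), trace_pow_succ, Nat.card_eq_fintype_card,
    Fintype.card_subtype]
  simp [nonbacktrackingMatrix, Finset.prod_ite_zero]

theorem dartSymmMatrix_mul {m : Type*} (M : Matrix G.Dart m K) :
    J * M = M.submatrix Dart.symm id := by
  ext a x
  simp [dartSymmMatrix, Matrix.mul_apply]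

theorem dartSymmMatrix_mul_fst : J * S = T := by
  rw [dartSymmMatrix_mul]; rfl

theorem dartSymmMatrix_mul_snd : J * T = S := by
  rw [dartSymmMatrix_mul]; rfl

theorem dartSymmMatrix_mul_self : J * J = 1 := by
  rw [dartSymmMatrix_mul]
  ext a b
  simp [dartSymmMatrix, Matrix.one_apply, eq_comm]

theorem transpose_dartFstMatrix_mul_snd : Sᵀ * T = G.adjMatrix K := by
  ext u v
  simp only [dartFstMatrix, dartSndMatrix, Matrix.mul_apply, Matrix.transpose_apply,
    Matrix.of_apply, ← ite_and, mul_ite, mul_one, mul_zero, adjMatrix_apply]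
  rw [Finset.sum_boole]
  split_ifs with h
  · rw [Finset.card_eq_one.2 ⟨⟨(u, v), h⟩, ?_⟩, Nat.cast_one]
    ext a
    simp [Dart.ext_iff, Prod.ext_iff, and_comm]
  · rw [Finset.card_eq_zero.2, Nat.cast_zero]
    simp only [Finset.filter_eq_empty_iff, Finset.mem_univ, true_imp_iff, not_and]
    rintro a rfl rfl
    exact h a.adj

theorem transpose_dartFstMatrix_mul_self {d : ℕ} (hreg : G.IsRegularOfDegree d) :
    Sᵀ * S = (d : K) • 1 := by
  ext u v
  simp only [dartFstMatrix, Matrix.mul_apply, Matrix.transpose_apply, Matrix.of_apply,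
    mul_ite, mul_one, mul_zero, Matrix.smul_apply, Matrix.one_apply, smul_eq_mul]
  split_ifs with h
  · subst h
    rw [← hreg u, ← dart_fst_fiber_card_eq_degree]
    simp [Finset.sum_ite, Finset.filter_filter]
  · refine Finset.sum_eq_zero fun a _ => ?_
    grind

theorem transpose_dartSndMatrix_mul_self {d : ℕ} (hreg : G.IsRegularOfDegree d) :
    Tᵀ * T = (d : K) • 1 := by
  rw [← dartSymmMatrix_mul_fst, transpose_mul, transpose_dartSymmMatrix, Matrix.mul_assoc,
    ← Matrix.mul_assoc J, dartSymmMatrix_mul_self, Matrix.one_mul,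
    transpose_dartFstMatrix_mul_self hreg]

theorem transpose_dartFstMatrix_mul_symm : Sᵀ * J = Tᵀ := by
  rw [← dartSymmMatrix_mul_fst, transpose_mul, transpose_dartSymmMatrix]

theorem nonbacktrackingMatrix_mul_snd : B * T = T * G.adjMatrix K - S := by
  rw [nonbacktrackingMatrix_eq, Matrix.sub_mul, Matrix.mul_assoc, transpose_dartFstMatrix_mul_snd,
    dartSymmMatrix_mul_snd]

theorem nonbacktrackingMatrix_mul_fst {d : ℕ} (hreg : G.IsRegularOfDegree d) :
    B * S = ((d : K) - 1) • T := by
  rw [nonbacktrackingMatrix_eq, Matrix.sub_mul, Matrix.mul_assoc,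
    transpose_dartFstMatrix_mul_self hreg, dartSymmMatrix_mul_fst, Matrix.mul_smul, Matrix.mul_one,
    sub_smul, one_smul]

theorem nonbacktrackingMatrix_mul_symm : B * J = T * Tᵀ - 1 := by
  rw [nonbacktrackingMatrix_eq, Matrix.sub_mul, Matrix.mul_assoc, transpose_dartFstMatrix_mul_symm,
    dartSymmMatrix_mul_self]

theorem trace_nonbacktrackingMatrix_pow_add_two (n : ℕ) :
    trace (B ^ (n + 2)) = trace (Sᵀ * B ^ (n + 1) * T - Tᵀ * B ^ n * T) + trace (B ^ n) := by
  have h : B ^ (n + 2) = B ^ (n + 1) * T * Sᵀ - (B ^ n * T * Tᵀ - B ^ n) := by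
    conv_lhs => rw [pow_succ]; enter [2]; rw [nonbacktrackingMatrix_eq]
    rw [Matrix.mul_sub, ← Matrix.mul_assoc, pow_succ _ n, Matrix.mul_assoc (B ^ n) B J,
      nonbacktrackingMatrix_mul_symm, Matrix.mul_sub, Matrix.mul_one, Matrix.mul_assoc (B ^ n) T Tᵀ]
  rw [h, trace_sub, trace_sub, trace_sub, trace_mul_comm _ Sᵀ, trace_mul_comm _ Tᵀ,
    Matrix.mul_assoc, Matrix.mul_assoc]
  ring

theorem nonbacktrackingMatrix_pow_add_two_mul_snd {d : ℕ} (hreg : G.IsRegularOfDegree d) (n : ℕ) :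
    B ^ (n + 2) * T = B ^ (n + 1) * T * G.adjMatrix K - ((d : K) - 1) • (B ^ n * T) := by
  rw [pow_succ, Matrix.mul_assoc, nonbacktrackingMatrix_mul_snd, Matrix.mul_sub,
    ← Matrix.mul_assoc, sub_right_inj, pow_succ, Matrix.mul_assoc,
    nonbacktrackingMatrix_mul_fst hreg, Matrix.mul_smul]

open Polynomial in
theorem transpose_mul_nonbacktrackingMatrix_pow_sub {d : ℕ} (hreg : G.IsRegularOfDegree d) (n : ℕ) :
    Sᵀ * B ^ (n + 1) * T - Tᵀ * B ^ n * T =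
      aeval (G.adjMatrix K) (dickson 1 ((d : K) - 1) (n + 2) - dickson 1 ((d : K) - 1) n) := by
  have hA : Tᵀ * S = G.adjMatrix K := by
    rw [← transpose_dartFstMatrix_mul_symm, Matrix.mul_assoc, dartSymmMatrix_mul_fst,
      transpose_dartFstMatrix_mul_snd]
  have hz : aeval (G.adjMatrix K) (dickson 1 ((d : K) - 1) 0) = (2 : K) • 1 := by
    rw [dickson_one_zero, aeval_C, Algebra.algebraMap_eq_smul_one]
  have hone : aeval (G.adjMatrix K) (dickson 1 ((d : K) - 1) 1) = G.adjMatrix K := by simp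
  have hd (m : ℕ) : aeval (G.adjMatrix K) (dickson 1 ((d : K) - 1) (m + 2)) =
      aeval (G.adjMatrix K) (dickson 1 ((d : K) - 1) (m + 1)) * G.adjMatrix K -
        ((d : K) - 1) • aeval (G.adjMatrix K) (dickson 1 ((d : K) - 1) m) := by
    rw [dickson_add_two, mul_comm X]
    simp [Algebra.smul_def]
  have hT := nonbacktrackingMatrix_pow_add_two_mul_snd (K := K) hreg
  have hB := nonbacktrackingMatrix_mul_snd (G := G) (K := K)
  have h0 : Sᵀ * (B * T) - Tᵀ * T = G.adjMatrix K * G.adjMatrix K - (2 * d : K) • 1 := by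
    rw [hB, Matrix.mul_sub, ← Matrix.mul_assoc, transpose_dartFstMatrix_mul_snd,
      transpose_dartFstMatrix_mul_self hreg, transpose_dartSndMatrix_mul_self hreg]
    module
  rw [map_sub]
  induction n using Nat.twoStepInduction with
  | zero =>
    rw [hd, zero_add, hone, hz, pow_one, pow_zero, Matrix.mul_one, Matrix.mul_assoc, h0]
    module
  | one =>
    rw [Matrix.mul_assoc, hT, Matrix.mul_assoc Tᵀ, hd, hd 0, hz, zero_add, hone, pow_one, pow_zero,
      Matrix.one_mul, hB]
    simp only [Matrix.mul_sub, Matrix.sub_mul, Matrix.mul_smul, Matrix.smul_mul,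
      ← Matrix.mul_assoc, hA, transpose_dartFstMatrix_mul_snd,
      transpose_dartFstMatrix_mul_self hreg, transpose_dartSndMatrix_mul_self hreg, Matrix.one_mul]
    module
  | more n h1 h2 =>
    have key : Sᵀ * B ^ (n + 2 + 1) * T - Tᵀ * B ^ (n + 2) * T =
        (Sᵀ * B ^ (n + 1 + 1) * T - Tᵀ * B ^ (n + 1) * T) * G.adjMatrix K -
          ((d : K) - 1) • (Sᵀ * B ^ (n + 1) * T - Tᵀ * B ^ n * T) := by
      rw [Matrix.mul_assoc, Matrix.mul_assoc Tᵀ, hT n, hT (n + 1)]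
      simp only [Matrix.mul_sub, Matrix.sub_mul, Matrix.mul_smul, ← Matrix.mul_assoc]
      module
    rw [key, h1, h2, hd (n + 2), hd n]
    simp only [Matrix.sub_mul]
    module

open Polynomial in
/-- The trace of a power of the non-backtracking matrix of a regular graph, in terms of Dickson
polynomials in the adjacency matrix. -/
theorem trace_nonbacktrackingMatrix_pow [Invertible (2 : K)] {d : ℕ}
    (hreg : G.IsRegularOfDegree d) (n : ℕ) :
    trace (B ^ n) = ⅟2 * Fintype.card V * ((d : K) - 2) * (1 + (-1) ^ n) +
      trace (aeval (G.adjMatrix K) (dickson 1 ((d : K) - 1) n)) := by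
  induction n using Nat.twoStepInduction with
  | zero =>
    have h2 : (⅟2 : K) * 2 = 1 := invOf_mul_self 2
    have hc : (Fintype.card G.Dart : K) = Fintype.card V * d := by
      simp [dart_card_eq_sum_degrees, hreg.degree_eq]
    rw [dickson_one_zero, aeval_C, Algebra.algebraMap_eq_smul_one, pow_zero, trace_one, trace_smul,
      trace_one, hc, smul_eq_mul]
    linear_combination -(Fintype.card V * ((d : K) - 2)) * h2
  | one => simp [trace, nonbacktrackingMatrix]
  | more n h1 _ =>
    rw [trace_nonbacktrackingMatrix_pow_add_two, transpose_mul_nonbacktrackingMatrix_pow_sub hreg,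
      h1, map_sub, trace_sub]
    ring

end SimpleGraph


open Polynomial in
open Classical in
/-- For a finite `d`-regular simple graph `G` (`d ≥ 3`) on `g` vertices whose
adjacency matrix has eigenvalues `α₁,…,α_g`, with `β_i^±` the two roots of
`x² − α_i x + (d−1) = 0`, the number `w_k` of closed non-backtracking `k`-walks satisfies
`w_k = Tr(R^k) = (1/2)g(d−2)(1 + (−1)^k) + ∑ᵢ ((β_i^+)^k + (β_i^−)^k)` for every `k ≥ 2`. -/
theorem stmt_16 {V : Type*} [Fintype V] [DecidableEq V] (G : SimpleGraph V)
    [DecidableRel G.Adj] (d g : ℕ) (hd : 3 ≤ d)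
    (hreg : G.IsRegularOfDegree d) (hg : Fintype.card V = g)
    (α βp βm : Fin g → ℂ)
    (hα : (G.adjMatrix ℂ).charpoly = ∏ i, (X - C (α i)))
    (hβ : ∀ i, βp i + βm i = α i ∧ βp i * βm i = (d:ℂ) - 1)
    (R : Matrix G.Dart G.Dart ℂ)
    (hR : ∀ a b : G.Dart, R a b = if b.fst = a.snd ∧ b ≠ a.symm then 1 else 0)
    (k : ℕ) (hk : 2 ≤ k) (w : ℕ)
    (hw : w = Nat.card {v : ZMod k → V //
        ∀ j : ZMod k, G.Adj (v j) (v (j + 1)) ∧ v (j + 2) ≠ v j}) :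
    (w : ℂ) = Matrix.trace (R ^ k) ∧
    (w : ℂ) = (1/2) * (g : ℂ) * ((d:ℂ) - 2) * (1 + (-1) ^ k) +
        ∑ i : Fin g, ((βp i) ^ k + (βm i) ^ k) := by
  subst hw hg
  obtain rfl : R = G.nonbacktrackingMatrix ℂ := by
    ext a b
    simp [hR, SimpleGraph.nonbacktrackingMatrix]
  obtain ⟨n, rfl⟩ : ∃ n, k = n + 1 := ⟨k - 1, by omega⟩
  have hroots : (G.adjMatrix ℂ).charpoly.roots = Finset.univ.val.map α := by
    have h := roots_multiset_prod_X_sub_C (Finset.univ.val.map α)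
    rw [Multiset.map_map] at h
    exact hα ▸ h
  have htr := G.trace_nonbacktrackingMatrix_pow_succ (K := ℂ) n
  refine ⟨by convert htr.symm, ?_⟩
  rw [← htr, SimpleGraph.trace_nonbacktrackingMatrix_pow hreg,
    Matrix.IsHermitian.trace_aeval (G.isHermitian_adjMatrix ℂ), hroots, Multiset.map_map]
  congr 1
  · simp
  · refine Finset.sum_congr rfl fun i _ => ?_
    rw [Function.comp_apply, ← (hβ i).1, ← (hβ i).2, eval_dickson_one_add]
end
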